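/- Composite i.i.d. null versus convex composite i.i.d. alternative, with both optimisations outside the limit. Let ℋ = ℂ^d be a finite-dimensional Hilbert space and 𝒜₁, ℬ₁ ⊆ 𝒟(ℋ) two non-empty closed sets of states, with ℬ₁ additionally convex. Then Stein(𝒜₁^{iid}‖ℬ₁^{iid}) = min*_{ρ∈𝒜₁, μ∈𝒫(ℬ₁)} lim_{n→∞} (1/n) D(ρ^{⊗n} ‖ ∫_{ℬ₁} dμ(σ) σ^{⊗n}), where the minimum is restricted to those pairs (ρ,μ) for which the inner limit in n exists (a non-empty set on which the minimum is attained). -/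

import Mathlib

open Filter MeasureTheory Topology
open scoped BigOperators Classical ComplexOrder

noncomputable section

namespace QSanov

/-- Matrices representing operators on the single-copy Hilbert space with orthonormal
basis indexed by `ι`. -/
abbrev MatC (ι : Type*) := Matrix ι ι ℂ

/-- Matrices representing operators on the `n`-fold tensor power Hilbert space. -/
abbrev MatN (ι : Type*) (n : ℕ) := Matrix (Fin n → ι) (Fin n → ι) ℂ

instance matMeasurableSpace (m n : Type*) : MeasurableSpace (Matrix m n ℂ) :=
  inferInstanceAs (MeasurableSpace (m → n → ℂ))

/-- A quantum state: a positive semidefinite matrix of trace one. -/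
def IsState {κ : Type*} [Fintype κ] (ρ : Matrix κ κ ℂ) : Prop :=
  ρ.PosSemidef ∧ ρ.trace = 1

/-- Loewner order: `A ≤ B` iff `B - A` is positive semidefinite. -/
def loewnerLE {κ : Type*} [Fintype κ] (A B : Matrix κ κ ℂ) : Prop :=
  (B - A).PosSemidef

/-- The `n`-fold tensor power `ρ^{⊗n}` of a single-copy matrix. -/
def tensorPow {ι : Type*} (ρ : MatC ι) (n : ℕ) : MatN ι n :=
  fun i j => ∏ k, ρ (i k) (j k)

/-- The tensor product `ρ₁ ⊗ ⋯ ⊗ ρ_n` of a family of single-copy matrices. -/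
def tensorProdFam {ι : Type*} {n : ℕ} (ρ : Fin n → MatC ι) : MatN ι n :=
  fun i j => ∏ k, ρ k (i k) (j k)

/-- The tensor product of an `n`-copy matrix and an `m`-copy matrix. -/
def tensorMul {ι : Type*} {n m : ℕ} (ρ : MatN ι n) (σ : MatN ι m) : MatN ι (n + m) :=
  fun i j => ρ (fun t => i (Fin.castAdd m t)) (fun t => j (Fin.castAdd m t)) *
    σ (fun t => i (Fin.natAdd n t)) (fun t => j (Fin.natAdd n t))

/-- Conjugation `U_π ρ U_π†` by the unitary permuting the `n` tensor factors. -/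
def permCopies {ι : Type*} {n : ℕ} (π : Equiv.Perm (Fin n)) (ρ : MatN ι n) : MatN ι n :=
  fun i j => ρ (i ∘ π) (j ∘ π)

/-- Matrix logarithm via functional calculus on the support (eigenvalue `0` is sent
to `0`, since `Real.log 0 = 0`). -/
def matLog {κ : Type*} [Fintype κ] [DecidableEq κ] (A : Matrix κ κ ℂ) : Matrix κ κ ℂ :=
  if hA : A.IsHermitian then
    (hA.eigenvectorUnitary : Matrix κ κ ℂ) *
      (Matrix.diagonal fun i => (Real.log (hA.eigenvalues i) : ℂ)) *
      (star (hA.eigenvectorUnitary : Matrix κ κ ℂ))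
  else 0

/-- Support inclusion `supp ρ ⊆ supp σ`, phrased as inclusion of ranges. -/
def suppLE {κ : Type*} [Fintype κ] [DecidableEq κ] (ρ σ : Matrix κ κ ℂ) : Prop :=
  LinearMap.range (Matrix.toLin' ρ) ≤ LinearMap.range (Matrix.toLin' σ)

/-- Umegaki relative entropy `D(ρ‖σ) = Tr[ρ (log ρ - log σ)]`, equal to `+∞` when
`supp ρ ⊄ supp σ`. -/
def relEnt {κ : Type*} [Fintype κ] [DecidableEq κ] (ρ σ : Matrix κ κ ℂ) : EReal :=
  if suppLE ρ σ then (((ρ * (matLog ρ - matLog σ)).trace.re : ℝ) : EReal) else ⊤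

/-- Relative entropy between two sets of states: `D(𝒜‖ℬ) = inf_{ρ∈𝒜, σ∈ℬ} D(ρ‖σ)`. -/
def relEntSet {κ : Type*} [Fintype κ] [DecidableEq κ] (A B : Set (Matrix κ κ ℂ)) : EReal :=
  ⨅ ρ ∈ A, ⨅ σ ∈ B, relEnt ρ σ

/-- The composite i.i.d. hypothesis `𝒻₁^{⊗n, iid}` built on the base set `F1`. -/
def iidSet {ι : Type*} (F1 : Set (MatC ι)) (n : ℕ) : Set (MatN ι n) :=
  {ρ | ∃ σ ∈ F1, ρ = tensorPow σ n}

/-- The arbitrarily varying hypothesis `𝒻₁^{⊗n, av}` built on the base set `F1`. -/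
def avSet {ι : Type*} (F1 : Set (MatC ι)) (n : ℕ) : Set (MatN ι n) :=
  {ρ | ∃ f : Fin n → MatC ι, (∀ p, f p ∈ F1) ∧ ρ = tensorProdFam f}

/-- Worst-case type II error probability `β_ε(A‖B)` for a threshold `ε` on the
worst-case type I error probability. -/
def typeII {κ : Type*} [Fintype κ] [DecidableEq κ] (A B : Set (Matrix κ κ ℂ)) (ε : ℝ) : ℝ :=
  sInf {b : ℝ | ∃ E : Matrix κ κ ℂ, E.PosSemidef ∧ (1 - E).PosSemidef ∧
    (∀ ρ ∈ A, (ρ * (1 - E)).trace.re ≤ ε) ∧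
    b = sSup {x : ℝ | ∃ σ ∈ B, x = (σ * E).trace.re}}

/-- `- log x`, with value `+∞` for `x ≤ 0`. -/
def negLog (x : ℝ) : EReal := if x ≤ 0 then ⊤ else ((-Real.log x : ℝ) : EReal)

/-- `(1/n : EReal)`. -/
def cFrac (n : ℕ) : EReal := (((n : ℝ)⁻¹ : ℝ) : EReal)

/-- The Stein exponent `Stein(𝒜‖ℬ) = lim_{ε→0⁺} liminf_n -(1/n) log β_ε(𝒜_n‖ℬ_n)`;
since the inner quantity is monotone nondecreasing in `ε`, the limit as `ε → 0⁺`
coincides with the infimum over `ε ∈ (0,1)`. -/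
def steinExponent {ι : Type*} [Fintype ι] [DecidableEq ι]
    (A B : ∀ n : ℕ, Set (MatN ι n)) : EReal :=
  ⨅ ε ∈ Set.Ioo (0 : ℝ) 1,
    Filter.liminf (fun n : ℕ => cFrac n * negLog (typeII (A n) (B n) ε)) Filter.atTop

/-- The mixture `∫ dμ(σ) σ^{⊗n}` of i.i.d. states along a measure `μ` on a set of
states `C` (Bochner integral, computed entrywise). -/
def iidMix {ι : Type*} {C : Set (MatC ι)} (μ : Measure ↥C) (n : ℕ) : MatN ι n :=
  fun i j => ∫ σ, (∏ k, (σ : MatC ι) (i k) (j k)) ∂μ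

/-- The `b`-th block of size `k` of an index of `ℋ^{⊗ mk}`. -/
def blockOf {ι : Type*} {m k : ℕ} (i : Fin (m * k) → ι) (b : Fin m) : Fin k → ι :=
  fun t => i (finProdFinEquiv (b, t))

/-- Replace the blocks in `S` of the index `i` by the values prescribed by `c`. -/
def mergeBlocks {ι : Type*} {m k : ℕ} (S : Finset (Fin m)) (c : Fin m → Fin k → ι)
    (i : Fin (m * k) → ι) : Fin (m * k) → ι :=
  fun p => if (finProdFinEquiv.symm p).1 ∈ S
    then c (finProdFinEquiv.symm p).1 (finProdFinEquiv.symm p).2 else i p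

/-- Entry `(i,j)` of the partial trace of `ρ` over the blocks in `S`
(the remaining blocks being evaluated at `i`, `j`). -/
def blockPartialTrace {ι : Type*} [Fintype ι] {m k : ℕ} (S : Finset (Fin m))
    (ρ : MatN ι (m * k)) (i j : Fin (m * k) → ι) : ℂ :=
  (((Fintype.card ι : ℂ) ^ (k * (m - S.card)))⁻¹) *
    ∑ c : Fin m → Fin k → ι, ρ (mergeBlocks S c i) (mergeBlocks S c j)

/-- The `m`-fold tensor power `(𝒩^δ_ω)^{⊗ m}` of the depolarising channel
`𝒩^δ_ω(X) = (1-δ) X + δ Tr[X] ω`, acting blockwise on blocks of `k` tensor factors. -/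
def blockDepolarize {ι : Type*} [Fintype ι] (δ : ℝ) {k : ℕ} (ω : MatN ι k) (m : ℕ)
    (ρ : MatN ι (m * k)) : MatN ι (m * k) :=
  fun i j => ∑ S : Finset (Fin m),
    (((1 - δ) ^ (m - S.card) * δ ^ S.card : ℝ) : ℂ) *
      ((∏ b ∈ S, ω (blockOf i b) (blockOf j b)) * blockPartialTrace S ρ i j)

/-- The `m`-fold tensor power of a `k`-copy matrix, as an `mk`-copy matrix. -/
def powBlocks {ι : Type*} {k : ℕ} (ρ : MatN ι k) (m : ℕ) : MatN ι (m * k) :=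
  fun i j => ∏ b : Fin m, ρ (blockOf i b) (blockOf j b)

/-- `Tr_{n+1,…,n+k}[ρ (𝟙^{⊗n} ⊗ F)]`, the filtered reduction of an `(n+k)`-copy matrix. -/
def condReduce {ι : Type*} [Fintype ι] {n k : ℕ} (ρ : MatN ι (n + k)) (F : MatN ι k) :
    MatN ι n :=
  fun i j => ∑ a : Fin k → ι, ∑ b : Fin k → ι,
    ρ (Fin.append i a) (Fin.append j b) * F b a

/-- Partial trace over the `k`-th tensor factor. -/
def traceOutAt {ι : Type*} [Fintype ι] {n : ℕ} (k : Fin (n + 1)) (σ : MatN ι (n + 1)) :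
    MatN ι n :=
  fun i j => ∑ a : ι, σ (k.insertNth a i) (k.insertNth a j)

/-- Insert the single-copy state `τ` at position `k` into an `n`-copy matrix. -/
def insertState {ι : Type*} {n : ℕ} (k : Fin (n + 1)) (τ : MatC ι) (σ : MatN ι n) :
    MatN ι (n + 1) :=
  fun i j => τ (i k) (j k) *
    σ (fun t => i (k.succAbove t)) (fun t => j (k.succAbove t))

/-- Product of a state on `A^n` and a state on `B^n`, viewed as a state on
`(ℋ_A ⊗ ℋ_B)^{⊗ n}` (reordering tensor factors implicitly). -/
def prodStateAB {ιA ιB : Type*} {n : ℕ} (α : Matrix (Fin n → ιA) (Fin n → ιA) ℂ)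
    (β : Matrix (Fin n → ιB) (Fin n → ιB) ℂ) : MatN (ιA × ιB) n :=
  fun i j => α (fun k => (i k).1) (fun k => (j k).1) * β (fun k => (i k).2) (fun k => (j k).2)


/-- The set `𝒮_{A^n:B^n}` of separable states across the cut `A^n : B^n`. -/
def sepSet (ιA ιB : Type*) [Fintype ιA] [Fintype ιB] (n : ℕ) : Set (MatN (ιA × ιB) n) :=
  convexHull ℝ {ρ | ∃ α β, IsState α ∧ IsState β ∧ ρ = prodStateAB α β}

/-- Classical relative entropy of two finitely supported output distributions. -/
def clRelEnt {m : ℕ} (P Q : Fin m → ℝ) : EReal :=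
  ∑ x, (if P x = 0 then (0 : EReal) else if Q x = 0 then (⊤ : EReal)
    else ((P x * Real.log (P x / Q x) : ℝ) : EReal))

/-- Measured relative entropy: supremum over all finite POVMs of the classical
relative entropy of the induced outcome distributions. -/
def measuredRelEnt {κ : Type*} [Fintype κ] [DecidableEq κ] (ρ σ : Matrix κ κ ℂ) : EReal :=
  ⨆ (m : ℕ) (E : Fin m → Matrix κ κ ℂ) (_ : ∀ x, (E x).PosSemidef) (_ : ∑ x, E x = 1),
    clRelEnt (fun x => (ρ * E x).trace.re) (fun x => (σ * E x).trace.re)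


/-- Axiom Q.I: there is a full-support free state `τ ∈ 𝒜₁` such that every `𝒜_{mk}`
is stable under blockwise depolarising towards `τ^{⊗k}`. -/
def AxiomQI {ι : Type*} [Fintype ι] [DecidableEq ι] (A : ∀ n : ℕ, Set (MatN ι n)) : Prop :=
  ∃ τ : MatC ι, tensorPow τ 1 ∈ A 1 ∧
    ∀ m k : ℕ, 1 ≤ m → 1 ≤ k → ∀ ρ ∈ A (m * k),
      suppLE ρ (tensorPow τ (m * k)) ∧
      ∀ δ ∈ Set.Icc (0 : ℝ) 1, blockDepolarize δ (tensorPow τ k) m ρ ∈ A (m * k)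

/-- Axiom Q.II: closedness under tensor powers. -/
def AxiomQII {ι : Type*} (A : ∀ n : ℕ, Set (MatN ι n)) : Prop :=
  ∀ m k : ℕ, 1 ≤ m → 1 ≤ k → ∀ ρ ∈ A k, powBlocks ρ m ∈ A (m * k)

/-- Axiom Q.III: closedness under permutations of the tensor factors. -/
def AxiomQIII {ι : Type*} (A : ∀ n : ℕ, Set (MatN ι n)) : Prop :=
  ∀ n : ℕ, ∀ ρ ∈ A n, ∀ π : Equiv.Perm (Fin n), permCopies π ρ ∈ A n

/-- Axiom Q.IV: filtering by Hermitian operators in a neighbourhood of the identity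
is completely `cone(𝒜)`-preserving. -/
def AxiomQIV {ι : Type*} [Fintype ι] [DecidableEq ι] (A : ∀ n : ℕ, Set (MatN ι n)) : Prop :=
  ∀ k : ℕ, 1 ≤ k →
    ∃ V : Set (MatN ι k), V ∈ nhds (1 : MatN ι k) ∧
      ∀ F ∈ V, F.IsHermitian → ∀ n : ℕ, 1 ≤ n → ∀ ρ ∈ A (n + k),
        ∃ (lam : ℝ) (ω : MatN ι n), 0 ≤ lam ∧ ω ∈ A n ∧ condReduce ρ F = (lam : ℂ) • ω


section Spectral

variable {κ : Type*} [Fintype κ] [DecidableEq κ]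

/-- The matrix with real eigenvalues `s` in the orthonormal basis of columns of `U`. -/
def spec (U : Matrix.unitaryGroup κ ℂ) (s : κ → ℝ) : Matrix κ κ ℂ :=
  (U : Matrix κ κ ℂ) * Matrix.diagonal (fun a => (s a : ℂ)) * star (U : Matrix κ κ ℂ)

/-- Diagonal entries of `ρ` in the orthonormal basis of columns of `U`. -/
def dg (ρ : Matrix κ κ ℂ) (U : Matrix.unitaryGroup κ ℂ) (a : κ) : ℝ :=
  ((star (U : Matrix κ κ ℂ) * ρ * (U : Matrix κ κ ℂ)) a a).re

lemma star_mul_self_unitary (U : Matrix.unitaryGroup κ ℂ) :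
    star (U : Matrix κ κ ℂ) * (U : Matrix κ κ ℂ) = 1 := Unitary.coe_star_mul_self U

lemma mul_star_self_unitary (U : Matrix.unitaryGroup κ ℂ) :
    (U : Matrix κ κ ℂ) * star (U : Matrix κ κ ℂ) = 1 := Unitary.coe_mul_star_self U

lemma exists_spec {A : Matrix κ κ ℂ} (hA : A.IsHermitian) :
    A = spec hA.eigenvectorUnitary hA.eigenvalues := by
  conv_lhs => rw [hA.spectral_theorem]
  rfl

lemma spec_isHermitian (U : Matrix.unitaryGroup κ ℂ) (s : κ → ℝ) : (spec U s).IsHermitian := by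
  unfold spec
  rw [Matrix.star_eq_conjTranspose]
  apply Matrix.isHermitian_mul_mul_conjTranspose
  rw [Matrix.isHermitian_diagonal_iff]
  intro i
  simp [IsSelfAdjoint]

lemma spec_mul (U : Matrix.unitaryGroup κ ℂ) (s t : κ → ℝ) :
    spec U s * spec U t = spec U (fun a => s a * t a) := by
  unfold spec
  calc _ = (U : Matrix κ κ ℂ) * Matrix.diagonal (fun a => (s a : ℂ)) *
        (star (U : Matrix κ κ ℂ) * (U : Matrix κ κ ℂ)) *
        Matrix.diagonal (fun a => (t a : ℂ)) * star (U : Matrix κ κ ℂ) := by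
        simp only [mul_assoc]
    _ = _ := by
        rw [star_mul_self_unitary, mul_one, mul_assoc (U : Matrix κ κ ℂ), Matrix.diagonal_mul_diagonal]
        simp

lemma spec_one (U : Matrix.unitaryGroup κ ℂ) : spec U (fun _ => 1) = 1 := by
  unfold spec
  simp

lemma spec_sub (U : Matrix.unitaryGroup κ ℂ) (s t : κ → ℝ) :
    spec U s - spec U t = spec U (fun a => s a - t a) := by
  unfold spec
  rw [← sub_mul, ← mul_sub, Matrix.diagonal_sub]
  simp

lemma spec_add (U : Matrix.unitaryGroup κ ℂ) (s t : κ → ℝ) :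
    spec U s + spec U t = spec U (fun a => s a + t a) := by
  unfold spec
  rw [← add_mul, ← mul_add, Matrix.diagonal_add]
  simp

lemma smul_spec (U : Matrix.unitaryGroup κ ℂ) (s : κ → ℝ) (c : ℝ) :
    (c : ℂ) • spec U s = spec U (fun a => c * s a) := by
  unfold spec
  have : Matrix.diagonal (fun a => ((c * s a : ℝ) : ℂ)) =
      (c : ℂ) • Matrix.diagonal (fun a => (s a : ℂ)) := by
    rw [← Matrix.diagonal_smul]; congr 1; ext a; simp
  rw [this]; simp

lemma spec_posSemidef (U : Matrix.unitaryGroup κ ℂ) {s : κ → ℝ} (hs : ∀ a, 0 ≤ s a) :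
    (spec U s).PosSemidef := by
  unfold spec
  rw [Matrix.star_eq_conjTranspose]
  apply Matrix.PosSemidef.mul_mul_conjTranspose_same
  rw [Matrix.posSemidef_diagonal_iff]
  intro i
  exact_mod_cast hs i

lemma star_mul_spec_mul (U : Matrix.unitaryGroup κ ℂ) (s : κ → ℝ) :
    star (U : Matrix κ κ ℂ) * spec U s * (U : Matrix κ κ ℂ) =
      Matrix.diagonal (fun a => (s a : ℂ)) := by
  unfold spec
  calc _ = (star (U : Matrix κ κ ℂ) * (U : Matrix κ κ ℂ)) *
        Matrix.diagonal (fun a => (s a : ℂ)) * (star (U : Matrix κ κ ℂ) * (U : Matrix κ κ ℂ)) := by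
        simp only [mul_assoc]
    _ = _ := by rw [star_mul_self_unitary]; simp

lemma dg_nonneg {ρ : Matrix κ κ ℂ} (hρ : ρ.PosSemidef) (U : Matrix.unitaryGroup κ ℂ) (a : κ) :
    0 ≤ dg ρ U a := by
  have h := (hρ.conjTranspose_mul_mul_same (U : Matrix κ κ ℂ)).diag_nonneg (i := a)
  rw [← Matrix.star_eq_conjTranspose] at h
  exact (Complex.le_def.1 h).1

lemma nonneg_of_spec_posSemidef {U : Matrix.unitaryGroup κ ℂ} {s : κ → ℝ}
    (h : (spec U s).PosSemidef) (a : κ) : 0 ≤ s a := by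
  have := dg_nonneg h U a
  simpa [dg, star_mul_spec_mul] using this

lemma trace_mul_spec (ρ : Matrix κ κ ℂ) (U : Matrix.unitaryGroup κ ℂ) (s : κ → ℝ) :
    (ρ * spec U s).trace.re = ∑ a, dg ρ U a * s a := by
  have : (ρ * spec U s).trace =
      ((star (U : Matrix κ κ ℂ) * ρ * (U : Matrix κ κ ℂ)) *
        Matrix.diagonal (fun a => (s a : ℂ))).trace := by
    unfold spec
    rw [← mul_assoc, ← mul_assoc, Matrix.trace_mul_comm]
    simp only [mul_assoc]
  rw [this, Matrix.trace, Complex.re_sum]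
  refine Finset.sum_congr rfl fun a _ => ?_
  simp [Matrix.mul_diagonal, dg]

lemma sum_dg (ρ : Matrix κ κ ℂ) (U : Matrix.unitaryGroup κ ℂ) :
    ∑ a, dg ρ U a = ρ.trace.re := by
  have := trace_mul_spec ρ U (fun _ => 1)
  rw [spec_one] at this
  simpa using this.symm

lemma dg_spec (U V : Matrix.unitaryGroup κ ℂ) (t : κ → ℝ) (a : κ) :
    dg (spec V t) U a =
      ∑ i, t i * Complex.normSq ((star (V : Matrix κ κ ℂ) * (U : Matrix κ κ ℂ)) i a) := by
  have : star (U : Matrix κ κ ℂ) * spec V t * (U : Matrix κ κ ℂ) =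
      star (star (V : Matrix κ κ ℂ) * (U : Matrix κ κ ℂ)) *
        (Matrix.diagonal (fun a => (t a : ℂ)) * (star (V : Matrix κ κ ℂ) * (U : Matrix κ κ ℂ))) := by
    unfold spec
    rw [star_mul, star_star]
    simp only [mul_assoc]
  rw [dg, this, Matrix.mul_apply, Complex.re_sum]
  refine Finset.sum_congr rfl fun i _ => ?_
  rw [Matrix.diagonal_mul, Matrix.star_apply]
  simp [Complex.normSq_apply]
  ring

lemma spec_congr {U V : Matrix.unitaryGroup κ ℂ} {s t : κ → ℝ} (h : spec U s = spec V t)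
    (f : ℝ → ℝ) : spec U (fun a => f (s a)) = spec V (fun a => f (t a)) := by
  set W : Matrix κ κ ℂ := star (V : Matrix κ κ ℂ) * (U : Matrix κ κ ℂ) with hW
  have key : ∀ g r : κ → ℝ, spec U g = spec V r ↔
      W * Matrix.diagonal (fun a => (g a : ℂ)) = Matrix.diagonal (fun a => (r a : ℂ)) * W := by
    intro g r
    have e1 : star (V : Matrix κ κ ℂ) * spec U g * (U : Matrix κ κ ℂ) =
        W * Matrix.diagonal (fun a => (g a : ℂ)) := by
      unfold spec
      simp only [mul_assoc, star_mul_self_unitary, hW, mul_one]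
    have e2 : star (V : Matrix κ κ ℂ) * spec V r * (U : Matrix κ κ ℂ) =
        Matrix.diagonal (fun a => (r a : ℂ)) * W := by
      unfold spec
      rw [← mul_assoc, ← mul_assoc, star_mul_self_unitary, one_mul, hW]
      simp only [mul_assoc]
    rw [← e1, ← e2]
    constructor
    · intro h; rw [h]
    · intro h
      have h2 := congrArg (fun X => (V : Matrix κ κ ℂ) * X * star (U : Matrix κ κ ℂ)) h
      simp only [mul_assoc, mul_star_self_unitary, mul_one] at h2
      simpa only [← mul_assoc, mul_star_self_unitary, one_mul] using h2
  rw [key] at h ⊢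
  ext i a
  have := congrFun (congrFun h i) a
  rw [Matrix.mul_diagonal, Matrix.diagonal_mul] at this ⊢
  by_cases hz : W i a = 0
  · simp [hz]
  · have h3 : (s a : ℂ) = t i := by
      rw [mul_comm] at this
      exact mul_right_cancel₀ hz this
    have : s a = t i := by exact_mod_cast h3
    rw [this, mul_comm]

lemma matLog_spec (U : Matrix.unitaryGroup κ ℂ) (s : κ → ℝ) :
    matLog (spec U s) = spec U (fun a => Real.log (s a)) := by
  unfold matLog
  rw [dif_pos (spec_isHermitian U s)]
  exact (spec_congr (exists_spec (spec_isHermitian U s)) Real.log).symm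

lemma suppLE_iff {ρ σ : Matrix κ κ ℂ} : suppLE ρ σ ↔ ∃ X, ρ = σ * X := by
  constructor
  · intro h
    have : ∀ j, ∃ x : κ → ℂ, σ.mulVec x = ρ.mulVec (Pi.single j 1) := by
      intro j
      have := h (LinearMap.mem_range_self (Matrix.toLin' ρ) (Pi.single j 1))
      obtain ⟨x, hx⟩ := this
      exact ⟨x, by simpa [Matrix.toLin'_apply] using hx⟩
    choose x hx using this
    refine ⟨fun i j => x j i, ?_⟩
    ext i j
    have := congrFun (hx j) i
    rw [Matrix.mulVec_single_one] at this
    simp only [Matrix.col_apply] at this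
    rw [← this]
    rfl
  · rintro ⟨X, rfl⟩
    unfold suppLE
    rw [Matrix.toLin'_mul]
    exact LinearMap.range_comp_le_range _ _

lemma suppLE_spec_iff {ρ : Matrix κ κ ℂ} {U : Matrix.unitaryGroup κ ℂ} {s : κ → ℝ} :
    suppLE ρ (spec U s) ↔ ∀ a, s a = 0 → ∀ j, (star (U : Matrix κ κ ℂ) * ρ) a j = 0 := by
  rw [suppLE_iff]
  constructor
  · rintro ⟨X, rfl⟩ a ha j
    have : star (U : Matrix κ κ ℂ) * (spec U s * X) =
        Matrix.diagonal (fun a => (s a : ℂ)) * (star (U : Matrix κ κ ℂ) * X) := by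
      unfold spec
      simp only [← mul_assoc, star_mul_self_unitary, one_mul]
    rw [this, Matrix.diagonal_mul, ha]
    simp
  · intro h
    refine ⟨(U : Matrix κ κ ℂ) * Matrix.diagonal (fun a => (s a : ℂ)⁻¹) *
      (star (U : Matrix κ κ ℂ) * ρ), ?_⟩
    have : spec U s * ((U : Matrix κ κ ℂ) * Matrix.diagonal (fun a => (s a : ℂ)⁻¹) *
        (star (U : Matrix κ κ ℂ) * ρ)) = (U : Matrix κ κ ℂ) *
        (Matrix.diagonal (fun a => (s a : ℂ) * (s a : ℂ)⁻¹) * (star (U : Matrix κ κ ℂ) * ρ)) := by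
      unfold spec
      rw [← Matrix.diagonal_mul_diagonal]
      calc _ = (U : Matrix κ κ ℂ) * Matrix.diagonal (fun a => (s a : ℂ)) *
            (star (U : Matrix κ κ ℂ) * (U : Matrix κ κ ℂ)) *
            Matrix.diagonal (fun a => (s a : ℂ)⁻¹) * (star (U : Matrix κ κ ℂ) * ρ) := by
            simp only [mul_assoc]
        _ = _ := by rw [star_mul_self_unitary]; simp only [mul_assoc, one_mul]
    rw [this]
    have h2 : Matrix.diagonal (fun a => (s a : ℂ) * (s a : ℂ)⁻¹) * (star (U : Matrix κ κ ℂ) * ρ) =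
        star (U : Matrix κ κ ℂ) * ρ := by
      ext a j
      rw [Matrix.diagonal_mul]
      by_cases ha : s a = 0
      · rw [h a ha j]; simp
      · rw [mul_inv_cancel₀ (by exact_mod_cast ha), one_mul]
    rw [h2, ← mul_assoc, mul_star_self_unitary, one_mul]

end Spectral

section TestLowerBound

variable {κ : Type*} [Fintype κ] [DecidableEq κ]

lemma dg_spec_self (U : Matrix.unitaryGroup κ ℂ) (s : κ → ℝ) (a : κ) : dg (spec U s) U a = s a := by
  simp [dg, star_mul_spec_mul]

lemma dg_one (U : Matrix.unitaryGroup κ ℂ) (a : κ) : dg 1 U a = 1 := by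
  simp [dg]

lemma trace_spec (U : Matrix.unitaryGroup κ ℂ) (s : κ → ℝ) : (spec U s).trace.re = ∑ a, s a := by
  rw [← sum_dg _ U]
  exact Finset.sum_congr rfl fun a _ => dg_spec_self U s a

lemma sum_normSq_row (U V : Matrix.unitaryGroup κ ℂ) (i : κ) :
    ∑ j, Complex.normSq ((star (V : Matrix κ κ ℂ) * (U : Matrix κ κ ℂ)) i j) = 1 := by
  have h := dg_spec V U (fun _ => 1) i
  rw [spec_one, dg_one] at h
  rw [h]
  refine Finset.sum_congr rfl fun j _ => ?_
  rw [one_mul, ← Complex.normSq_conj, ← Complex.star_def, ← Matrix.star_apply, star_mul, star_star]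

lemma sum_normSq_col (U V : Matrix.unitaryGroup κ ℂ) (j : κ) :
    ∑ i, Complex.normSq ((star (V : Matrix κ κ ℂ) * (U : Matrix κ κ ℂ)) i j) = 1 := by
  have h := dg_spec U V (fun _ => 1) j
  rw [spec_one, dg_one] at h
  rw [h]
  exact Finset.sum_congr rfl fun i _ => (one_mul _).symm

lemma dg_mul_self {Y : Matrix κ κ ℂ} (hY : Y.IsHermitian) (U V : Matrix.unitaryGroup κ ℂ) (i : κ) :
    dg (Y * Y) V i =
      ∑ j, Complex.normSq ((star (V : Matrix κ κ ℂ) * Y * (U : Matrix κ κ ℂ)) i j) := by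
  have : star (V : Matrix κ κ ℂ) * (Y * Y) * (V : Matrix κ κ ℂ) =
      (star (V : Matrix κ κ ℂ) * Y * (U : Matrix κ κ ℂ)) *
        star (star (V : Matrix κ κ ℂ) * Y * (U : Matrix κ κ ℂ)) := by
    have hs : star Y = Y := hY
    rw [star_mul, star_mul, star_star, hs]
    calc _ = star (V : Matrix κ κ ℂ) * Y * 1 * Y * (V : Matrix κ κ ℂ) := by
          simp only [mul_assoc, one_mul]
      _ = _ := by rw [← mul_star_self_unitary U]; simp only [mul_assoc]
  rw [dg, this, Matrix.mul_apply, Complex.re_sum]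
  refine Finset.sum_congr rfl fun j _ => ?_
  rw [Matrix.star_apply, Complex.star_def, Complex.mul_conj, Complex.ofReal_re]

lemma trace_spec_mul_le {ρ : Matrix κ κ ℂ} (hρ : ρ.PosSemidef) (W : Matrix.unitaryGroup κ ℂ)
    {e f : κ → ℝ} (h : ∀ a, e a ≤ f a) :
    (ρ * spec W e).trace.re ≤ (ρ * spec W f).trace.re := by
  rw [trace_mul_spec, trace_mul_spec]
  exact Finset.sum_le_sum fun a _ => mul_le_mul_of_nonneg_left (h a) (dg_nonneg hρ W a)

/-- The relative entropy as that of the Nussbaum–Szkoła distributions. -/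
lemma relEnt_spec (U V : Matrix.unitaryGroup κ ℂ) (s t : κ → ℝ) :
    (spec V t * (matLog (spec V t) - matLog (spec U s))).trace.re =
      ∑ i, ∑ j, t i * Complex.normSq ((star (V : Matrix κ κ ℂ) * (U : Matrix κ κ ℂ)) i j) *
        (Real.log (t i) - Real.log (s j)) := by
  rw [mul_sub, Matrix.trace_sub, Complex.sub_re, matLog_spec, matLog_spec, trace_mul_spec,
    trace_mul_spec]
  simp only [mul_sub, Finset.sum_sub_distrib, dg_spec_self]
  congr 1
  · refine Finset.sum_congr rfl fun i _ => ?_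
    rw [← Finset.sum_mul, ← Finset.mul_sum, sum_normSq_row, mul_one]
  · rw [Finset.sum_comm]
    refine Finset.sum_congr rfl fun j _ => ?_
    rw [dg_spec, Finset.sum_mul]

/-- A weak converse: tests with small type I error cannot have a type II error much smaller than
`exp (-D)`. -/
lemma half_le_add_exp_mul_trace {ρ σ E : Matrix κ κ ℂ} (hρ : IsState ρ) (hσ : IsState σ)
    {D a ε : ℝ} (hD : relEnt ρ σ ≤ (D : EReal)) (ha : 0 < a) (hE : E.PosSemidef)
    (hE1 : (1 - E).PosSemidef) (hε : (ρ * (1 - E)).trace.re ≤ ε) :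
    (1 - (D + 1) / a) / 2 ≤ ε + Real.exp a * (σ * E).trace.re := by
  obtain ⟨V, t, rfl⟩ : ∃ V t, ρ = spec V t := ⟨_, _, exists_spec hρ.1.1⟩
  obtain ⟨U, s, rfl⟩ : ∃ U s, σ = spec U s := ⟨_, _, exists_spec hσ.1.1⟩
  obtain ⟨W, e, rfl⟩ : ∃ W e, E = spec W e := ⟨_, _, exists_spec hE.1⟩
  have ht : ∀ i, 0 ≤ t i := nonneg_of_spec_posSemidef hρ.1
  have hs : ∀ i, 0 ≤ s i := nonneg_of_spec_posSemidef hσ.1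
  have he : ∀ i, 0 ≤ e i := nonneg_of_spec_posSemidef hE
  rw [← spec_one W, spec_sub] at hE1 hε
  have he1 : ∀ i, 0 ≤ 1 - e i := nonneg_of_spec_posSemidef hE1
  have htsum : ∑ i, t i = 1 := by rw [← trace_spec V, hρ.2]; simp
  have hssum : ∑ i, s i = 1 := by rw [← trace_spec U, hσ.2]; simp
  set p : κ → κ → ℝ :=
    fun i j => Complex.normSq ((star (V : Matrix κ κ ℂ) * (U : Matrix κ κ ℂ)) i j) with hp
  have hp0 : ∀ i j, 0 ≤ p i j := fun i j => Complex.normSq_nonneg _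
  have hrow : ∀ i, ∑ j, p i j = 1 := sum_normSq_row U V
  have hcol : ∀ j, ∑ i, p i j = 1 := sum_normSq_col U V
  have hsupp : suppLE (spec V t) (spec U s) := by
    by_contra h
    rw [relEnt, if_neg h] at hD
    exact absurd (top_le_iff.1 hD) (EReal.coe_ne_top D)
  have hD' : ∑ i, ∑ j, t i * p i j * (Real.log (t i) - Real.log (s j)) ≤ D := by
    rw [relEnt, if_pos hsupp, relEnt_spec] at hD
    exact_mod_cast hD
  have hz : ∀ i j, s j = 0 → t i * p i j = 0 := by
    intro i j hj
    rw [suppLE_spec_iff] at hsupp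
    have h1 : (star (U : Matrix κ κ ℂ) * spec V t * (V : Matrix κ κ ℂ)) j i = 0 := by
      rw [Matrix.mul_apply]
      exact Finset.sum_eq_zero fun k _ => by rw [hsupp j hj k, zero_mul]
    have h2 : star (U : Matrix κ κ ℂ) * spec V t * (V : Matrix κ κ ℂ) =
        star (star (V : Matrix κ κ ℂ) * (U : Matrix κ κ ℂ)) *
          Matrix.diagonal (fun a => (t a : ℂ)) := by
      unfold spec
      rw [star_mul, star_star]
      simp only [mul_assoc, star_mul_self_unitary, mul_one]
    rw [h2, Matrix.mul_diagonal, Matrix.star_apply] at h1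
    rcases mul_eq_zero.1 h1 with h | h
    · have : p i j = 0 := by simp only [hp]; rw [star_eq_zero.1 h]; simp
      rw [this, mul_zero]
    · have : t i = 0 := by exact_mod_cast h
      rw [this, zero_mul]
  -- the Markov inequality for the log-likelihood ratio
  have hmark : a * ∑ i, ∑ j, (if t i ≤ Real.exp a * s j then 0 else t i * p i j) ≤ D + 1 := by
    have hpt : ∀ i j, a * (if t i ≤ Real.exp a * s j then 0 else t i * p i j) ≤
        t i * p i j * (Real.log (t i) - Real.log (s j)) + s j * p i j := by
      intro i j
      rcases eq_or_lt_of_le (mul_nonneg (ht i) (hp0 i j)) with h0 | h0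
      · rw [← h0]
        simp [mul_nonneg (hs j) (hp0 i j)]
      · have hti : 0 < t i := by
          rcases (ht i).eq_or_lt with h | h
          · rw [← h] at h0; simp at h0
          · exact h
        have hsj : 0 < s j := by
          rcases (hs j).eq_or_lt with h | h
          · rw [hz i j h.symm] at h0; exact absurd h0 (lt_irrefl _)
          · exact h
        have hpij : 0 ≤ p i j := hp0 i j
        split_ifs with hc
        · have := Real.log_le_sub_one_of_pos (div_pos hsj hti)
          rw [Real.log_div hsj.ne' hti.ne'] at this
          have h3 : t i * (Real.log (s j) - Real.log (t i)) ≤ s j := by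
            calc t i * (Real.log (s j) - Real.log (t i)) ≤ t i * (s j / t i - 1) :=
                  mul_le_mul_of_nonneg_left this hti.le
              _ = s j - t i := by field_simp
              _ ≤ s j := by linarith
          nlinarith
        · push Not at hc
          have h4 : a ≤ Real.log (t i) - Real.log (s j) := by
            have := Real.log_le_log (by positivity) hc.le
            rw [Real.log_mul (Real.exp_pos a).ne' hsj.ne', Real.log_exp] at this
            linarith
          nlinarith [mul_nonneg hsj.le hpij]
    calc _ = ∑ i, ∑ j, a * (if t i ≤ Real.exp a * s j then 0 else t i * p i j) := by
          simp only [Finset.mul_sum]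
      _ ≤ ∑ i, ∑ j, (t i * p i j * (Real.log (t i) - Real.log (s j)) + s j * p i j) :=
          Finset.sum_le_sum fun i _ => Finset.sum_le_sum fun j _ => hpt i j
      _ = ∑ i, ∑ j, t i * p i j * (Real.log (t i) - Real.log (s j)) + ∑ i, ∑ j, s j * p i j := by
          simp only [Finset.sum_add_distrib]
      _ ≤ D + 1 := by
          refine add_le_add hD' (le_of_eq ?_)
          rw [Finset.sum_comm]
          simp only [← Finset.mul_sum, hcol, mul_one, hssum]
  -- the error probabilities in terms of the two eigenbases
  set N : Matrix κ κ ℂ :=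
    star (V : Matrix κ κ ℂ) * spec W (fun a => 1 - e a) * (U : Matrix κ κ ℂ) with hN
  set K : Matrix κ κ ℂ := star (V : Matrix κ κ ℂ) * spec W e * (U : Matrix κ κ ℂ) with hK
  have h1 : ∑ i, ∑ j, t i * Complex.normSq (N i j) ≤ ε := by
    refine le_trans (le_of_eq ?_) ((trace_spec_mul_le hρ.1 W
      (e := fun a => (1 - e a) * (1 - e a)) (f := fun a => 1 - e a) fun a => ?_).trans hε)
    · rw [← spec_mul, Matrix.trace_mul_comm, trace_mul_spec]
      refine Finset.sum_congr rfl fun i _ => ?_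
      rw [dg_mul_self (spec_isHermitian _ _) U V, mul_comm, Finset.mul_sum]
    · nlinarith [he a, he1 a]
  have h2 : ∑ i, ∑ j, s j * Complex.normSq (K i j) ≤ (spec U s * spec W e).trace.re := by
    refine le_trans (le_of_eq ?_) (trace_spec_mul_le hσ.1 W
      (e := fun a => e a * e a) (f := e) fun a => ?_)
    · rw [← spec_mul, Matrix.trace_mul_comm, trace_mul_spec, Finset.sum_comm]
      refine Finset.sum_congr rfl fun j _ => ?_
      rw [dg_mul_self (spec_isHermitian _ _) V U, mul_comm, Finset.mul_sum]
      refine Finset.sum_congr rfl fun i _ => ?_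
      have : star (U : Matrix κ κ ℂ) * spec W e * (V : Matrix κ κ ℂ) = star K := by
        have hs : star (spec W e) = spec W e := spec_isHermitian W e
        rw [hK, star_mul, star_mul, star_star, hs, mul_assoc]
      rw [this, Matrix.star_apply, Complex.star_def, Complex.normSq_conj]
    · nlinarith [he a, he1 a]
  have hNK : ∀ i j, p i j ≤ 2 * Complex.normSq (N i j) + 2 * Complex.normSq (K i j) := by
    intro i j
    have : star (V : Matrix κ κ ℂ) * (U : Matrix κ κ ℂ) = N + K := by
      rw [hN, hK, ← add_mul, ← mul_add, spec_add]
      simp [spec_one]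
    simp only [hp, this, Matrix.add_apply, Complex.normSq_apply, Complex.add_re, Complex.add_im]
    nlinarith [sq_nonneg ((N i j).re - (K i j).re), sq_nonneg ((N i j).im - (K i j).im)]
  have hG : ∑ i, ∑ j, (t i * p i j - (if t i ≤ Real.exp a * s j then 0 else t i * p i j)) ≤
      2 * (ε + Real.exp a * (spec U s * spec W e).trace.re) := by
    calc _ ≤ ∑ i, ∑ j, (2 * (t i * Complex.normSq (N i j)) +
          2 * Real.exp a * (s j * Complex.normSq (K i j))) := by
          refine Finset.sum_le_sum fun i _ => Finset.sum_le_sum fun j _ => ?_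
          have hN0 := Complex.normSq_nonneg (N i j)
          have hK0 := Complex.normSq_nonneg (K i j)
          have hea := Real.exp_pos a
          split_ifs with hc
          · have := mul_le_mul_of_nonneg_left (hNK i j) (ht i)
            have := mul_le_mul_of_nonneg_right hc hK0
            nlinarith
          · have := mul_nonneg (ht i) hN0
            have := mul_nonneg hea.le (mul_nonneg (hs j) hK0)
            nlinarith
      _ = 2 * ∑ i, ∑ j, t i * Complex.normSq (N i j) +
          2 * Real.exp a * ∑ i, ∑ j, s j * Complex.normSq (K i j) := by
          simp only [Finset.sum_add_distrib, Finset.mul_sum]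
      _ ≤ _ := by
          have := mul_le_mul_of_nonneg_left h2 (Real.exp_pos a).le
          nlinarith
  simp only [Finset.sum_sub_distrib, ← Finset.mul_sum, hrow, mul_one, htsum] at hG
  have h5 : ∑ i, ∑ j, (if t i ≤ Real.exp a * s j then 0 else t i * p i j) ≤ (D + 1) / a := by
    rw [le_div_iff₀ ha]
    linarith
  linarith

end TestLowerBound

section Pinching

variable {κ : Type*} [Fintype κ] [DecidableEq κ]

/-- An orthonormal eigenbasis of `spec U s` in which `ρ` is diagonal on every eigenspace. -/
lemma exists_spec_eq_of_isHermitian {ρ : Matrix κ κ ℂ} (hρ : ρ.IsHermitian)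
    (U : Matrix.unitaryGroup κ ℂ) (s : κ → ℝ) :
    ∃ W : Matrix.unitaryGroup κ ℂ, spec U s = spec W s ∧
      ∀ a b, a ≠ b → s a = s b → (star (W : Matrix κ κ ℂ) * ρ * (W : Matrix κ κ ℂ)) a b = 0 := by
  set r : Matrix κ κ ℂ := star (U : Matrix κ κ ℂ) * ρ * (U : Matrix κ κ ℂ) with hr
  have hrH : r.IsHermitian := by
    rw [hr, Matrix.star_eq_conjTranspose]
    exact Matrix.isHermitian_conjTranspose_mul_mul _ hρ
  have hM : ∀ c : ℝ, (r.submatrix (Subtype.val : {a // s a = c} → κ) Subtype.val).IsHermitian :=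
    fun c => hrH.submatrix _
  set X : ∀ c : ℝ, Matrix {a // s a = c} {a // s a = c} ℂ :=
    fun c => ((hM c).eigenvectorUnitary : Matrix _ _ ℂ) with hX
  set V : Matrix κ κ ℂ := Matrix.of fun a b => if h : s a = s b then X (s b) ⟨a, h⟩ ⟨b, rfl⟩ else 0
    with hV
  have hV0 : ∀ a b, s a ≠ s b → V a b = 0 := fun a b h => by simp [hV, h]
  have hVX : ∀ (c : ℝ) (a b : {a // s a = c}), V a b = X c a b := by
    rintro c ⟨a, ha⟩ ⟨b, rfl⟩
    simp [hV, ha]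
  have hsum : ∀ (c : ℝ) (b : {a // s a = c}) (g : κ → ℂ),
      ∑ a, g a * V a b = ∑ a : {a // s a = c}, g a * X c a b := by
    intro c b g
    rw [← Finset.sum_subset (Finset.subset_univ (Finset.univ.filter fun a => s a = c)),
      Finset.sum_subtype (p := fun a => s a = c) _ (by simp)]
    · exact Finset.sum_congr rfl fun a _ => by rw [hVX]
    · intro a _ ha
      rw [hV0 a b, mul_zero]
      rw [b.2]
      simpa using ha
  have hVV : star V * V = 1 := by
    ext a b
    rw [Matrix.mul_apply]
    by_cases hab : s a = s b
    · have h1 := hsum (s b) ⟨b, rfl⟩ (fun k => (star V) a k)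
      rw [h1]
      have h2 := congrFun (congrFun (star_mul_self_unitary (hM (s b)).eigenvectorUnitary)
        ⟨a, hab⟩) ⟨b, rfl⟩
      rw [Matrix.mul_apply] at h2
      rw [show (1 : Matrix κ κ ℂ) a b = (1 : Matrix {x // s x = s b} {x // s x = s b} ℂ)
        ⟨a, hab⟩ ⟨b, rfl⟩ by simp [Matrix.one_apply], ← h2]
      refine Finset.sum_congr rfl fun k _ => ?_
      rw [Matrix.star_apply, Matrix.star_apply]
      congr 2
      exact hVX (s b) k ⟨a, hab⟩
    · rw [Matrix.one_apply_ne (fun h => hab (congrArg s h))]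
      refine Finset.sum_eq_zero fun k _ => ?_
      by_cases hk : s k = s a
      · rw [hV0 k b (by rw [hk]; exact hab), mul_zero]
      · rw [Matrix.star_apply, hV0 k a hk]; simp
  have hVu : V ∈ Matrix.unitaryGroup κ ℂ := by
    rw [Matrix.mem_unitaryGroup_iff']; exact hVV
  refine ⟨U * ⟨V, hVu⟩, ?_, ?_⟩
  · have hcomm : Matrix.diagonal (fun a => (s a : ℂ)) * V =
        V * Matrix.diagonal (fun a => (s a : ℂ)) := by
      ext a b
      rw [Matrix.diagonal_mul, Matrix.mul_diagonal]
      by_cases hab : s a = s b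
      · rw [hab, mul_comm]
      · rw [hV0 a b hab]; simp
    have hVV' : V * star V = 1 := mul_star_self_unitary ⟨V, hVu⟩
    unfold spec
    simp only [Submonoid.coe_mul, star_mul]
    calc _ = (U : Matrix κ κ ℂ) * (Matrix.diagonal (fun a => (s a : ℂ)) * (V * star V)) *
          star (U : Matrix κ κ ℂ) := by rw [hVV', mul_one]
      _ = (U : Matrix κ κ ℂ) * (Matrix.diagonal (fun a => (s a : ℂ)) * V) * star V *
          star (U : Matrix κ κ ℂ) := by simp only [mul_assoc]
      _ = _ := by rw [hcomm]; simp only [mul_assoc]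
  · intro a b hne hab
    have : star ((U * ⟨V, hVu⟩ : Matrix.unitaryGroup κ ℂ) : Matrix κ κ ℂ) * ρ *
        ((U * ⟨V, hVu⟩ : Matrix.unitaryGroup κ ℂ) : Matrix κ κ ℂ) = star V * (r * V) := by
      simp only [Submonoid.coe_mul, star_mul, hr, mul_assoc]
    rw [this, Matrix.mul_apply]
    have hspec := star_mul_spec_mul (hM (s b)).eigenvectorUnitary (hM (s b)).eigenvalues
    rw [← exists_spec, mul_assoc] at hspec
    have h2 := congrFun (congrFun hspec ⟨a, hab⟩) ⟨b, rfl⟩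
    rw [Matrix.diagonal_apply_ne _ (by simpa using hne), Matrix.mul_apply] at h2
    rw [← h2]
    have h3 : ∀ k, (star V) a k * (r * V) k b = (r * V) k b * star (V k a) := fun k => by
      rw [Matrix.star_apply, mul_comm]
    simp only [h3]
    have h4 : ∀ k, (r * V) k b = ∑ j : {x // s x = s b}, r k j * X (s b) j ⟨b, rfl⟩ := by
      intro k
      rw [Matrix.mul_apply]
      exact hsum (s b) ⟨b, rfl⟩ (fun j => r k j)
    have h5 := congrArg star (hsum (s b) ⟨a, hab⟩ (fun k => star ((r * V) k b)))
    simp only [star_sum, star_mul', star_star] at h5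
    rw [h5]
    refine Finset.sum_congr rfl fun k _ => ?_
    rw [h4, Matrix.star_apply, Matrix.mul_apply, mul_comm]
    rfl

lemma re_dotProduct_mulVec_spec (V W : Matrix.unitaryGroup κ ℂ) (t : κ → ℝ) (y : κ → ℂ) :
    (star y ⬝ᵥ (star (W : Matrix κ κ ℂ) * spec V t * (W : Matrix κ κ ℂ)).mulVec y).re =
      ∑ i, t i * Complex.normSq ((star (V : Matrix κ κ ℂ) * (W : Matrix κ κ ℂ)).mulVec y i) := by
  set X := star (V : Matrix κ κ ℂ) * (W : Matrix κ κ ℂ) with hX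
  have : star (W : Matrix κ κ ℂ) * spec V t * (W : Matrix κ κ ℂ) =
      X.conjTranspose * (Matrix.diagonal (fun a => (t a : ℂ)) * X) := by
    rw [hX, ← Matrix.star_eq_conjTranspose, star_mul, star_star]
    unfold spec
    simp only [mul_assoc]
  clear_value X
  rw [this, ← Matrix.mulVec_mulVec, Matrix.dotProduct_mulVec, Matrix.vecMul_conjTranspose, star_star,
    ← Matrix.mulVec_mulVec, dotProduct, Complex.re_sum]
  refine Finset.sum_congr rfl fun i _ => ?_
  rw [Matrix.mulVec_diagonal, Pi.star_apply, Complex.star_def,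
    show (starRingEnd ℂ) (X.mulVec y i) * ((t i : ℂ) * X.mulVec y i) =
      (t i : ℂ) * (X.mulVec y i * (starRingEnd ℂ) (X.mulVec y i)) by ring, Complex.mul_conj]
  simp

/-- If all tests of the variational formula for the measured relative entropy are bounded, then so
is the relative entropy, up to the logarithm of the number of eigenvalues of `σ`. -/
lemma relEnt_le_of_forall_posDef {ρ σ : Matrix κ κ ℂ} (hρ : IsState ρ) (hσ : IsState σ)
    {U : Matrix.unitaryGroup κ ℂ} {s : κ → ℝ} (hU : σ = spec U s) {v : ℕ}
    (hv : (Finset.univ.image s).card ≤ v) {c : ℝ}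
    (h : ∀ ω : Matrix κ κ ℂ, ω.PosDef →
      (ρ * matLog ω).trace.re ≤ c + Real.log (σ * ω).trace.re) :
    relEnt ρ σ ≤ ((c + Real.log v : ℝ) : EReal) := by
  obtain ⟨W, hW, hdiag⟩ := exists_spec_eq_of_isHermitian hρ.1.1 U s
  rw [hW] at hU
  clear hW
  subst hU
  obtain ⟨V, t, rfl⟩ : ∃ V t, ρ = spec V t := ⟨_, _, exists_spec hρ.1.1⟩
  have ht : ∀ i, 0 ≤ t i := nonneg_of_spec_posSemidef hρ.1
  have hs : ∀ i, 0 ≤ s i := nonneg_of_spec_posSemidef hσ.1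
  have htsum : ∑ i, t i = 1 := by rw [← trace_spec V, hρ.2]; simp
  have hssum : ∑ i, s i = 1 := by rw [← trace_spec W, hσ.2]; simp
  set X : Matrix κ κ ℂ := star (V : Matrix κ κ ℂ) * (W : Matrix κ κ ℂ) with hX
  set p : κ → κ → ℝ := fun i j => Complex.normSq (X i j) with hp
  have hp0 : ∀ i j, 0 ≤ p i j := fun i j => Complex.normSq_nonneg _
  have hrow : ∀ i, ∑ j, p i j = 1 := sum_normSq_row W V
  set q : κ → ℝ := dg (spec V t) W with hq
  have hq0 : ∀ a, 0 ≤ q a := dg_nonneg hρ.1 W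
  have hqsum : ∑ a, q a = 1 := by rw [hq, sum_dg, hρ.2]; simp
  have hqp : ∀ a, q a = ∑ i, t i * p i a := fun a => dg_spec W V t a
  have hω : ∀ w : κ → ℝ, (∀ a, 0 < w a) →
      ∑ a, q a * Real.log (w a) ≤ c + Real.log (∑ a, s a * w a) := by
    intro w hw
    have hpd : (spec W w).PosDef := by
      unfold spec
      rw [Matrix.star_eq_conjTranspose]
      refine Matrix.PosDef.mul_mul_conjTranspose_same ?_ ?_
      · rw [Matrix.posDef_diagonal_iff]
        intro i
        exact_mod_cast hw i
      · intro x y hxy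
        have := congrArg (fun z => Matrix.vecMul z (star (W : Matrix κ κ ℂ))) hxy
        simpa [Matrix.vecMul_vecMul, mul_star_self_unitary] using this
    have := h _ hpd
    rw [matLog_spec, trace_mul_spec, trace_mul_spec] at this
    simpa only [dg_spec_self] using this
  have hzero : ∀ a, s a = 0 → q a = 0 := by
    intro a ha
    by_contra hqa
    have hqa' : 0 < q a := lt_of_le_of_ne (hq0 a) (Ne.symm hqa)
    have := hω (fun b => if b = a then Real.exp ((c + 1) / q a) else 1)
      (fun b => by split_ifs <;> positivity)
    have h1 : ∑ b, s b * (if b = a then Real.exp ((c + 1) / q a) else 1) = 1 := by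
      refine Eq.trans ?_ hssum
      refine Finset.sum_congr rfl fun b _ => ?_
      split_ifs with hb
      · rw [hb, ha, zero_mul]
      · rw [mul_one]
    have h2 : ∑ b, q b * Real.log (if b = a then Real.exp ((c + 1) / q a) else 1) = c + 1 := by
      rw [Finset.sum_eq_single a]
      · rw [if_pos rfl, Real.log_exp]; field_simp
      · intro b _ hb
        rw [if_neg hb, Real.log_one, mul_zero]
      · simp
    rw [h1, h2, Real.log_one] at this
    linarith
  have hcl : ∑ a, q a * (Real.log (q a) - Real.log (s a)) ≤ c := by
    refine le_of_forall_pos_le_add fun δ hδ => ?_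
    have hspos : ∀ a, q a ≠ 0 → 0 < s a := fun a ha =>
      lt_of_le_of_ne (hs a) (fun h0 => ha (hzero a h0.symm))
    have := hω (fun a => if q a = 0 then δ else q a / s a) (fun a => by
      split_ifs with h0
      · exact hδ
      · exact div_pos (lt_of_le_of_ne (hq0 a) (Ne.symm h0)) (hspos a h0))
    have h1 : ∑ a, q a * Real.log (if q a = 0 then δ else q a / s a) =
        ∑ a, q a * (Real.log (q a) - Real.log (s a)) := by
      refine Finset.sum_congr rfl fun a _ => ?_
      split_ifs with h0
      · rw [h0]; simp
      · rw [Real.log_div h0 (hspos a h0).ne']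
    have h2 : ∀ a, q a ≤ s a * (if q a = 0 then δ else q a / s a) := by
      intro a
      split_ifs with h0
      · rw [h0]; exact mul_nonneg (hs a) hδ.le
      · rw [mul_div_cancel₀ _ (hspos a h0).ne']
    have h3 : ∀ a, s a * (if q a = 0 then δ else q a / s a) ≤ q a + δ * s a := by
      intro a
      split_ifs with h0
      · rw [h0]; linarith
      · rw [mul_div_cancel₀ _ (hspos a h0).ne']
        have := mul_nonneg hδ.le (hs a)
        linarith
    have h4 : 1 ≤ ∑ a, s a * (if q a = 0 then δ else q a / s a) := by
      rw [← hqsum]; exact Finset.sum_le_sum fun a _ => h2 a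
    have h5 : ∑ a, s a * (if q a = 0 then δ else q a / s a) ≤ 1 + δ := by
      calc _ ≤ ∑ a, (q a + δ * s a) := Finset.sum_le_sum fun a _ => h3 a
        _ = 1 + δ := by rw [Finset.sum_add_distrib, ← Finset.mul_sum, hqsum, hssum, mul_one]
    have h6 := Real.log_le_sub_one_of_pos (lt_of_lt_of_le one_pos h4)
    rw [h1] at this
    linarith
  have hpz : ∀ i a, q a = 0 → t i * p i a = 0 := by
    intro i a ha
    rw [hqp] at ha
    exact (Finset.sum_eq_zero_iff_of_nonneg
      fun i _ => mul_nonneg (ht i) (hp0 i a)).1 ha i (Finset.mem_univ i)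
  have hsupp : suppLE (spec V t) (spec W s) := by
    rw [suppLE_spec_iff]
    intro a ha j
    have : star (W : Matrix κ κ ℂ) * spec V t =
        (star X * Matrix.diagonal (fun a => (t a : ℂ))) * star (V : Matrix κ κ ℂ) := by
      rw [hX, star_mul, star_star]
      unfold spec
      simp only [mul_assoc]
    rw [this, Matrix.mul_apply]
    refine Finset.sum_eq_zero fun i _ => ?_
    rw [Matrix.mul_diagonal, Matrix.star_apply]
    rcases mul_eq_zero.1 (hpz i a (hzero a ha)) with h0 | h0
    · rw [h0]; simp
    · rw [Complex.normSq_eq_zero.1 h0]; simp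
  -- the pinching inequality
  have hblock : ∀ i (x : ℝ), t i * ∑ a ∈ Finset.univ.filter (fun a => s a = x), p i a / q a ≤ 1 := by
    intro i x
    set T := ∑ a ∈ Finset.univ.filter (fun a => s a = x), p i a / q a with hT
    have hT0 : 0 ≤ T := Finset.sum_nonneg fun a _ => div_nonneg (hp0 i a) (hq0 a)
    set y : κ → ℂ := fun a => if s a = x then star (X i a) / (q a : ℂ) else 0 with hy
    have e1 : X.mulVec y i = (T : ℂ) := by
      rw [Matrix.mulVec, dotProduct, hT, Complex.ofReal_sum, Finset.sum_filter]
      refine Finset.sum_congr rfl fun a _ => ?_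
      simp only [hy]
      split_ifs
      · rw [mul_div_assoc', Complex.star_def, Complex.mul_conj]; simp [hp]
      · simp
    have e2 := re_dotProduct_mulVec_spec V W t y
    have e3 : t i * T ^ 2 ≤
        ∑ i, t i * Complex.normSq ((star (V : Matrix κ κ ℂ) * (W : Matrix κ κ ℂ)).mulVec y i) := by
      refine le_trans (le_of_eq ?_) (Finset.single_le_sum (f := fun i =>
        t i * Complex.normSq ((star (V : Matrix κ κ ℂ) * (W : Matrix κ κ ℂ)).mulVec y i))
        (fun i _ => mul_nonneg (ht i) (Complex.normSq_nonneg _)) (Finset.mem_univ i))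
      show _ = t i * Complex.normSq (X.mulVec y i)
      rw [e1, Complex.normSq_ofReal, sq]
    rw [← e2] at e3
    have e4 : (star y ⬝ᵥ (star (W : Matrix κ κ ℂ) * spec V t * (W : Matrix κ κ ℂ)).mulVec y).re
        = T := by
      rw [dotProduct, Complex.re_sum, hT, Finset.sum_filter]
      refine Finset.sum_congr rfl fun a _ => ?_
      rw [Pi.star_apply, Matrix.mulVec, dotProduct]
      by_cases ha : s a = x
      · rw [if_pos ha, Finset.sum_eq_single a]
        · have : y a = star (X i a) / (q a : ℂ) := by simp [hy, ha]
          rw [mul_left_comm, Complex.star_def, ← Complex.normSq_eq_conj_mul_self,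
            Complex.re_mul_ofReal, this, Complex.normSq_div, Complex.normSq_ofReal,
            Complex.star_def, Complex.normSq_conj]
          show q a * (p i a / (q a * q a)) = p i a / q a
          by_cases h0 : q a = 0
          · rw [h0]; simp
          · field_simp
        · intro b _ hb
          by_cases hsb : s b = x
          · rw [hdiag a b hb.symm (ha.trans hsb.symm), zero_mul]
          · simp [hy, hsb]
        · simp
      · rw [if_neg ha]
        simp [hy, ha]
    rw [e4] at e3
    rcases hT0.eq_or_lt with h0 | h0
    · rw [← h0]; simp
    · have : t i * T * T ≤ 1 * T := by nlinarith
      exact le_of_mul_le_mul_right this h0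
  have hpinch : ∀ i, t i * ∑ a, p i a / q a ≤ v := by
    intro i
    have : ∑ a, p i a / q a = ∑ x ∈ Finset.univ.image s,
        ∑ a ∈ Finset.univ.filter (fun a => s a = x), p i a / q a :=
      (Finset.sum_fiberwise_of_maps_to (fun a _ => Finset.mem_image_of_mem s (Finset.mem_univ a)) _).symm
    rw [this, Finset.mul_sum]
    calc _ ≤ ∑ x ∈ Finset.univ.image s, (1 : ℝ) := Finset.sum_le_sum fun x _ => hblock i x
      _ ≤ v := by
        rw [Finset.sum_const, nsmul_eq_mul, mul_one]
        exact_mod_cast hv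
  have hvpos : (0 : ℝ) < v := by
    have : (Finset.univ.image s).Nonempty := by
      rw [Finset.image_nonempty]
      by_contra h0
      rw [Finset.not_nonempty_iff_eq_empty] at h0
      rw [h0] at hssum
      simp at hssum
    exact_mod_cast lt_of_lt_of_le this.card_pos hv
  have hent : ∀ i, t i * Real.log (t i) ≤ t i * Real.log v + ∑ a, t i * p i a * Real.log (q a) := by
    intro i
    rcases (ht i).eq_or_lt with h0 | h0
    · rw [← h0]; simp
    have hle : ∀ a, p i a * (Real.log (t i) - Real.log v - Real.log (q a)) ≤
        t i / v * (p i a / q a) - p i a := by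
      intro a
      rcases (hq0 a).eq_or_lt with hqa | hqa
      · have : p i a = 0 := by
          rcases mul_eq_zero.1 (hpz i a hqa.symm) with h1 | h1
          · exact absurd h1 h0.ne'
          · exact h1
        rw [this]; simp
      · have := Real.log_le_sub_one_of_pos (show 0 < t i / v / q a by positivity)
        rw [Real.log_div (by positivity) hqa.ne', Real.log_div h0.ne' hvpos.ne'] at this
        calc _ ≤ p i a * (t i / v / q a - 1) := mul_le_mul_of_nonneg_left this (hp0 i a)
          _ = _ := by ring
    have hs1 := Finset.sum_le_sum fun a (_ : a ∈ Finset.univ) => hle a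
    rw [Finset.sum_sub_distrib, hrow, ← Finset.mul_sum] at hs1
    have hs2 : t i / v * ∑ a, p i a / q a ≤ 1 := by
      rw [div_mul_eq_mul_div, div_le_one hvpos]; exact hpinch i
    have hs3 : ∑ a, p i a * (Real.log (t i) - Real.log v - Real.log (q a)) =
        Real.log (t i) - Real.log v - ∑ a, p i a * Real.log (q a) := by
      simp only [mul_sub, Finset.sum_sub_distrib, ← Finset.sum_mul, hrow, one_mul]
    simp only [mul_assoc, ← Finset.mul_sum]
    rw [← mul_add]
    refine mul_le_mul_of_nonneg_left ?_ h0.le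
    linarith
  rw [relEnt, if_pos hsupp, relEnt_spec]
  rw [EReal.coe_le_coe_iff]
  have e1 : ∑ i, ∑ j, t i * Complex.normSq ((star (V : Matrix κ κ ℂ) * (W : Matrix κ κ ℂ)) i j) *
      (Real.log (t i) - Real.log (s j)) =
      ∑ i, t i * Real.log (t i) - ∑ a, q a * Real.log (s a) := by
    have e2 : ∑ a, q a * Real.log (s a) = ∑ i, ∑ a, t i * p i a * Real.log (s a) := by
      rw [Finset.sum_comm]
      refine Finset.sum_congr rfl fun a _ => ?_
      rw [hqp, Finset.sum_mul]
    rw [e2, ← Finset.sum_sub_distrib]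
    refine Finset.sum_congr rfl fun i _ => ?_
    show ∑ j, t i * p i j * _ = _
    simp only [mul_sub, Finset.sum_sub_distrib]
    rw [← Finset.sum_mul, ← Finset.mul_sum, hrow, mul_one]
  rw [e1]
  have e3 : ∑ a, q a * Real.log (q a) = ∑ i, ∑ a, t i * p i a * Real.log (q a) := by
    rw [Finset.sum_comm]
    refine Finset.sum_congr rfl fun a _ => ?_
    rw [← Finset.sum_mul, ← hqp]
  have e4 := Finset.sum_le_sum fun i (_ : i ∈ Finset.univ) => hent i
  rw [Finset.sum_add_distrib, ← Finset.sum_mul, htsum, one_mul, ← e3] at e4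
  simp only [mul_sub, Finset.sum_sub_distrib] at hcl
  linarith

end Pinching

section SoftTest

variable {κ : Type*} [Fintype κ] [DecidableEq κ]

lemma posSemidef_inv_sub_inv {A B A' B' : Matrix κ κ ℂ} (hA' : A'.IsHermitian)
    (hB' : B'.PosSemidef) (hA : A' * A = 1) (hA2 : A * A' = 1) (hB : B * B' = 1)
    (h : (A - B).PosSemidef) : (B' - A').PosSemidef := by
  have key : B' - A' = A' * (A - B) * A'.conjTranspose +
      (A' * (A - B)) * B' * (A' * (A - B)).conjTranspose := by
    have hD : (A - B).conjTranspose = A - B := h.1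
    have hA'' : A'.conjTranspose = A' := hA'
    rw [Matrix.conjTranspose_mul, hD, hA'']
    calc B' - A' = A' * (A - B) * B' := by
          rw [mul_sub, sub_mul, hA, one_mul, mul_assoc, hB, mul_one]
      _ = A' * (A - B) * B' * (A * A') := by rw [hA2, mul_one]
      _ = A' * (A - B) * B' * ((B + (A - B)) * A') := by rw [add_sub_cancel]
      _ = A' * (A - B) * (B' * B) * A' + A' * (A - B) * B' * ((A - B) * A') := by
          rw [add_mul, mul_add]; simp only [mul_assoc]
      _ = _ := by
          rw [mul_eq_one_comm.1 hB]
          simp only [mul_assoc, one_mul]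
  rw [key]
  exact (h.mul_mul_conjTranspose_same A').add (hB'.mul_mul_conjTranspose_same _)

lemma trace_mul_re_nonneg {ρ A : Matrix κ κ ℂ} (hρ : ρ.PosSemidef) (hA : A.PosSemidef) :
    0 ≤ (ρ * A).trace.re := by
  have hn := nonneg_of_spec_posSemidef (exists_spec hA.1 ▸ hA)
  rw [exists_spec hA.1, trace_mul_spec]
  exact Finset.sum_nonneg fun a _ => mul_nonneg (dg_nonneg hρ _ a) (hn a)

lemma trace_mul_re_mono {ρ A B : Matrix κ κ ℂ} (hρ : ρ.PosSemidef) (h : (B - A).PosSemidef) :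
    (ρ * A).trace.re ≤ (ρ * B).trace.re := by
  have := trace_mul_re_nonneg hρ h
  rw [mul_sub, Matrix.trace_sub, Complex.sub_re] at this
  linarith

/-- The test `W / (W + t)`. -/
lemma exists_soft_test {W : Matrix κ κ ℂ} (hW : W.PosSemidef) {t : ℝ} (ht : 0 < t) :
    ∃ E : Matrix κ κ ℂ, E.PosSemidef ∧ (1 - E).PosSemidef ∧
      (∀ σ : Matrix κ κ ℂ, σ.PosSemidef → (σ * E).trace.re ≤ (σ * W).trace.re / t) ∧
      ∀ (U : Matrix.unitaryGroup κ ℂ) (x : κ → ℝ), (∀ a, 0 < x a) →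
        (W - spec U x).PosSemidef → ∀ s : ℝ, 0 ≤ s → s ≤ 1 → ∀ ρ : Matrix κ κ ℂ, ρ.PosSemidef →
          (ρ * (1 - E)).trace.re ≤ t ^ s * (ρ * spec U (fun a => x a ^ (-s))).trace.re := by
  obtain ⟨V, w, rfl⟩ : ∃ V w, W = spec V w := ⟨_, _, exists_spec hW.1⟩
  have hw : ∀ i, 0 ≤ w i := nonneg_of_spec_posSemidef hW
  have hwt : ∀ i, 0 < w i + t := fun i => by linarith [hw i]
  have h1 : 1 - spec V (fun a => w a / (w a + t)) = spec V (fun a => t * (w a + t)⁻¹) := by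
    rw [← spec_one V, spec_sub]
    congr 1
    ext a
    have := (hwt a).ne'
    field_simp
    ring
  refine ⟨spec V (fun a => w a / (w a + t)), ?_, ?_, ?_, ?_⟩
  · exact spec_posSemidef _ fun a => div_nonneg (hw a) (hwt a).le
  · rw [h1]
    exact spec_posSemidef _ fun a => mul_nonneg ht.le (inv_nonneg.2 (hwt a).le)
  · intro σ hσ
    rw [trace_mul_spec, trace_mul_spec, Finset.sum_div]
    refine Finset.sum_le_sum fun a _ => ?_
    rw [mul_div_assoc]
    refine mul_le_mul_of_nonneg_left ?_ (dg_nonneg hσ V a)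
    exact div_le_div_of_nonneg_left (hw a) ht (by linarith [hw a])
  · intro U x hx hWX s hs0 hs1 ρ hρ
    have hxt : ∀ i, 0 < x i + t := fun i => by linarith [hx i]
    rw [h1, ← smul_spec]
    have hinv : (spec U (fun a => (x a + t)⁻¹) - spec V (fun a => (w a + t)⁻¹)).PosSemidef := by
      refine posSemidef_inv_sub_inv (A := spec V (fun a => w a + t)) (B := spec U (fun a => x a + t))
        (spec_isHermitian _ _) (spec_posSemidef _ fun a => inv_nonneg.2 (hxt a).le) ?_ ?_ ?_ ?_
      · rw [spec_mul, ← spec_one V]; congr 1; ext a; exact inv_mul_cancel₀ (hwt a).ne'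
      · rw [spec_mul, ← spec_one V]; congr 1; ext a; exact mul_inv_cancel₀ (hwt a).ne'
      · rw [spec_mul, ← spec_one U]; congr 1; ext a; exact mul_inv_cancel₀ (hxt a).ne'
      · have e1 : spec V (fun a => w a + t) = spec V w + (t : ℂ) • 1 := by
          rw [← spec_one V, smul_spec, spec_add]; simp
        have e2 : spec U (fun a => x a + t) = spec U x + (t : ℂ) • 1 := by
          rw [← spec_one U, smul_spec, spec_add]; simp
        rw [e1, e2, add_sub_add_right_eq_sub]
        exact hWX
    have h2 := trace_mul_re_mono hρ hinv
    rw [Matrix.mul_smul, Matrix.trace_smul, smul_eq_mul, Complex.re_ofReal_mul]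
    refine (mul_le_mul_of_nonneg_left h2 ht.le).trans ?_
    rw [trace_mul_spec, trace_mul_spec, Finset.mul_sum, Finset.mul_sum]
    refine Finset.sum_le_sum fun a _ => ?_
    rw [mul_left_comm, mul_left_comm (t ^ s)]
    refine mul_le_mul_of_nonneg_left ?_ (dg_nonneg hρ U a)
    have hy : 0 < x a / t := div_pos (hx a) ht
    have hpow : (x a / t) ^ s ≤ 1 + x a / t := by
      rcases le_total (x a / t) 1 with h | h
      · exact (Real.rpow_le_one hy.le h hs0).trans (by linarith)
      · calc (x a / t) ^ s ≤ (x a / t) ^ (1 : ℝ) := Real.rpow_le_rpow_of_exponent_le h hs1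
          _ ≤ _ := by rw [Real.rpow_one]; linarith
    rw [Real.div_rpow (hx a).le ht.le] at hpow
    have hxs := Real.rpow_pos_of_pos (hx a) s
    have hts := Real.rpow_pos_of_pos ht s
    rw [Real.rpow_neg (hx a).le, ← div_eq_mul_inv, ← div_eq_mul_inv, div_le_div_iff₀ (hxt a) hxs]
    have : x a ^ s ≤ t ^ s * (1 + x a / t) := by
      rw [div_le_iff₀ hts] at hpow; linarith
    calc t * x a ^ s ≤ t * (t ^ s * (1 + x a / t)) := mul_le_mul_of_nonneg_left this ht.le
      _ = t ^ s * (x a + t) := by field_simp; ring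

end SoftTest

section Tensor

set_option linter.unusedSectionVars false

open scoped Kronecker

lemma exists_eq_conjTranspose_mul_self {κ : Type*} [Fintype κ] [DecidableEq κ] {A : Matrix κ κ ℂ}
    (hA : A.PosSemidef) : ∃ B, A = Matrix.conjTranspose B * B := by
  have hn := nonneg_of_spec_posSemidef (exists_spec hA.1 ▸ hA)
  refine ⟨spec hA.1.eigenvectorUnitary fun a => Real.sqrt (hA.1.eigenvalues a), ?_⟩
  rw [(spec_isHermitian _ _).eq, spec_mul]
  conv_lhs => rw [exists_spec hA.1]
  congr 1
  ext a
  exact (Real.mul_self_sqrt (hn a)).symm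

/-- The trace of a product of Hermitian matrices is real. -/
lemma trace_mul_eq_ofReal {κ : Type*} [Fintype κ] {A B : Matrix κ κ ℂ}
    (hA : A.IsHermitian) (hB : B.IsHermitian) : (A * B).trace = ((A * B).trace.re : ℂ) := by
  refine (Complex.conj_eq_iff_re.1 ?_).symm
  rw [← Complex.star_def, ← Matrix.trace_conjTranspose, Matrix.conjTranspose_mul, hA.eq, hB.eq,
    Matrix.trace_mul_comm]

variable {ι : Type*} [Fintype ι] [DecidableEq ι]

lemma tensorPow_mul (A B : MatC ι) (n : ℕ) :
    tensorPow (A * B) n = tensorPow A n * tensorPow B n := by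
  ext i j
  simp only [tensorPow, Matrix.mul_apply]
  rw [Fintype.prod_sum]
  simp only [Finset.prod_mul_distrib]

lemma tensorPow_conjTranspose (A : MatC ι) (n : ℕ) :
    tensorPow A.conjTranspose n = (tensorPow A n).conjTranspose := by
  ext i j
  simp [tensorPow, Matrix.conjTranspose_apply]

lemma trace_tensorPow (A : MatC ι) (n : ℕ) : (tensorPow A n).trace = A.trace ^ n := by
  simp only [tensorPow, Matrix.trace, Matrix.diag_apply]
  rw [← Fintype.prod_sum fun (_ : Fin n) j => A j j]
  simp

lemma IsState.tensorPow {ρ : MatC ι} (hρ : IsState ρ) (n : ℕ) :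
    IsState (tensorPow ρ n) := by
  obtain ⟨B, hB⟩ := exists_eq_conjTranspose_mul_self hρ.1
  refine ⟨?_, by rw [trace_tensorPow, hρ.2, one_pow]⟩
  rw [hB, tensorPow_mul, tensorPow_conjTranspose]
  exact Matrix.posSemidef_conjTranspose_mul_self _

lemma tensorMul_eq {n m : ℕ} (ρ : MatN ι n) (σ : MatN ι m) :
    tensorMul ρ σ =
      (ρ ⊗ₖ σ).submatrix (Fin.appendEquiv n m).symm (Fin.appendEquiv n m).symm := rfl

lemma tensorPow_add (ρ : MatC ι) (n m : ℕ) :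
    tensorPow ρ (n + m) = tensorMul (tensorPow ρ n) (tensorPow ρ m) := by
  ext i j
  simp [tensorPow, tensorMul, Fin.prod_univ_add]

lemma trace_submatrix_equiv {κ ν : Type*} [Fintype κ] [Fintype ν] (A : Matrix κ κ ℂ)
    (e : ν ≃ κ) : (A.submatrix e e).trace = A.trace :=
  Equiv.sum_comp e fun i => A i i

lemma trace_tensorMul_mul {n m : ℕ} (ρ X : MatN ι n) (σ Y : MatN ι m) :
    (tensorMul ρ σ * tensorMul X Y).trace = (ρ * X).trace * (σ * Y).trace := by
  rw [tensorMul_eq, tensorMul_eq, Matrix.submatrix_mul_equiv, trace_submatrix_equiv,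
    ← Matrix.mul_kronecker_mul, Matrix.trace_kronecker]

lemma exists_tensorMul_spec {n m : ℕ} (U : Matrix.unitaryGroup (Fin n → ι) ℂ)
    (V : Matrix.unitaryGroup (Fin m → ι) ℂ) :
    ∃ W : Matrix.unitaryGroup (Fin (n + m) → ι) ℂ, ∀ x y,
      tensorMul (spec U x) (spec V y) = spec W fun a =>
        x ((Fin.appendEquiv n m).symm a).1 * y ((Fin.appendEquiv n m).symm a).2 := by
  set e := (Fin.appendEquiv (α := ι) n m).symm with he
  have hK := Matrix.kronecker_mem_unitary U.2 V.2
  have hmem : ((U : MatN ι n) ⊗ₖ (V : MatN ι m)).submatrix e e ∈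
      Matrix.unitaryGroup (Fin (n + m) → ι) ℂ := by
    rw [Matrix.mem_unitaryGroup_iff', Matrix.star_eq_conjTranspose, Matrix.conjTranspose_submatrix,
      Matrix.submatrix_mul_equiv, ← Matrix.star_eq_conjTranspose, (Unitary.mem_iff.1 hK).1,
      Matrix.submatrix_one_equiv]
  refine ⟨⟨_, hmem⟩, fun x y => ?_⟩
  rw [tensorMul_eq, ← he]
  unfold spec
  have hd : Matrix.diagonal (fun a => ((x (e a).1 * y (e a).2 : ℝ) : ℂ)) =
      (Matrix.diagonal (fun a => (x a : ℂ)) ⊗ₖ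
        Matrix.diagonal (fun a => (y a : ℂ))).submatrix e e := by
    rw [Matrix.diagonal_kronecker_diagonal, Matrix.submatrix_diagonal_equiv]
    congr 1
    ext a
    simp
  rw [hd]
  simp only [Matrix.star_eq_conjTranspose, Matrix.conjTranspose_submatrix,
    Matrix.submatrix_mul_equiv, Matrix.mul_kronecker_mul, Matrix.conjTranspose_kronecker]

/-- Blockwise powers of a positive definite matrix, padded by the identity. -/
lemma exists_block_pow {k : ℕ} (hk : 0 < k) (U : Matrix.unitaryGroup (Fin k → ι) ℂ)
    {x : (Fin k → ι) → ℝ} (hx : ∀ a, 0 < x a) (n : ℕ) :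
    ∃ (V : Matrix.unitaryGroup (Fin n → ι) ℂ) (y : (Fin n → ι) → ℝ), (∀ a, 0 < y a) ∧
      ∀ σ : MatC ι, IsState σ → ∀ s : ℝ,
        (tensorPow σ n * spec V fun a => y a ^ s).trace.re =
          ((tensorPow σ k * spec U fun a => x a ^ s).trace.re) ^ (n / k) := by
  induction n using Nat.strong_induction_on with
  | _ n ih =>
    rcases lt_or_ge n k with h | h
    · refine ⟨1, fun _ => 1, fun _ => one_pos, fun σ hσ s => ?_⟩
      rw [Nat.div_eq_of_lt h]
      simp only [Real.one_rpow, spec_one, mul_one]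
      rw [(hσ.tensorPow n).2]
      simp
    · obtain ⟨m, rfl⟩ := Nat.exists_eq_add_of_le' h
      obtain ⟨V, y, hy, hV⟩ := ih m (by omega)
      obtain ⟨W, hW⟩ := exists_tensorMul_spec V U
      refine ⟨W, fun a => y ((Fin.appendEquiv m k).symm a).1 * x ((Fin.appendEquiv m k).symm a).2,
        fun a => mul_pos (hy _) (hx _), fun σ hσ s => ?_⟩
      simp only [Real.mul_rpow (hy _).le (hx _).le]
      rw [← hW (fun a => y a ^ s) (fun a => x a ^ s), tensorPow_add, trace_tensorMul_mul,
        trace_mul_eq_ofReal (hσ.tensorPow m).1.1 (spec_isHermitian _ _),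
        trace_mul_eq_ofReal (hσ.tensorPow k).1.1 (spec_isHermitian _ _), ← Complex.ofReal_mul,
        Complex.ofReal_re, hV σ hσ s, Nat.add_div_right _ hk, pow_succ]
      simp only [Complex.ofReal_re]

end Tensor

section PermutationInvariance

set_option linter.unusedSectionVars false

variable {ι : Type*}

lemma exists_perm_comp_eq {α : Type*} [DecidableEq α] {n : ℕ} {f g : Fin n → α}
    (h : ∀ c, Fintype.card {x // f x = c} = Fintype.card {x // g x = c}) :
    ∃ π : Equiv.Perm (Fin n), g ∘ π = f := by
  have e : ∀ c, {x // f x = c} ≃ {x // g x = c} := fun c => Fintype.equivOfCardEq (h c)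
  refine ⟨(Equiv.sigmaFiberEquiv f).symm.trans
    ((Equiv.sigmaCongrRight e).trans (Equiv.sigmaFiberEquiv g)), ?_⟩
  ext x
  exact (e (f x) ⟨x, rfl⟩).2

/-- Matrices commuting with all permutations of the tensor factors. -/
def PermInv {n : ℕ} (A : MatN ι n) : Prop :=
  ∀ (π : Equiv.Perm (Fin n)) (i j : Fin n → ι), A (i ∘ π) (j ∘ π) = A i j

variable [Fintype ι] [DecidableEq ι]

lemma PermInv.mul {n : ℕ} {A B : MatN ι n} (hA : PermInv A) (hB : PermInv B) :
    PermInv (A * B) := by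
  intro π i j
  rw [Matrix.mul_apply, Matrix.mul_apply,
    ← Equiv.sum_comp (Equiv.arrowCongr π.symm (Equiv.refl ι))]
  refine Finset.sum_congr rfl fun k _ => ?_
  have : Equiv.arrowCongr π.symm (Equiv.refl ι) k = k ∘ π := by ext; simp
  rw [this, hA, hB]

lemma PermInv.pow {n : ℕ} {A : MatN ι n} (hA : PermInv A) (k : ℕ) : PermInv (A ^ k) := by
  induction k with
  | zero =>
    intro π i j
    rw [pow_zero, Matrix.one_apply, Matrix.one_apply]
    congr 1
    exact propext (π.surjective.injective_comp_right.eq_iff)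
  | succ k ih => rw [pow_succ]; exact ih.mul hA

/-- A matrix from a function of the type of the pair of indices. -/
def ofCounts (ι : Type*) [Fintype ι] [DecidableEq ι] (n : ℕ) :
    ((ι × ι → Fin (n + 1)) → ℂ) →ₗ[ℂ] MatN ι n where
  toFun g := fun i j => g fun c => ⟨Fintype.card {x // (i x, j x) = c},
    Nat.lt_succ_of_le ((Fintype.card_subtype_le _).trans_eq (Fintype.card_fin n))⟩
  map_add' _ _ := rfl
  map_smul' _ _ := rfl

lemma PermInv.mem_range {n : ℕ} {A : MatN ι n} (hA : PermInv A) :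
    A ∈ LinearMap.range (ofCounts ι n) := by
  set cnt : (Fin n → ι) × (Fin n → ι) → ι × ι → Fin (n + 1) := fun p c =>
    ⟨Fintype.card {x // (p.1 x, p.2 x) = c},
      Nat.lt_succ_of_le ((Fintype.card_subtype_le _).trans_eq (Fintype.card_fin n))⟩ with hcnt
  have hfac : ∀ p q, cnt p = cnt q → A p.1 p.2 = A q.1 q.2 := by
    intro p q hpq
    obtain ⟨π, hπ⟩ := exists_perm_comp_eq (f := fun x => (p.1 x, p.2 x))
      (g := fun x => (q.1 x, q.2 x)) fun c => by
        have := congrFun hpq c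
        simpa [hcnt] using this
    rw [← hA π q.1 q.2]
    congr 1
    · ext x; exact (congrArg Prod.fst (congrFun hπ x)).symm
    · ext x; exact (congrArg Prod.snd (congrFun hπ x)).symm
  have hf : (fun p : (Fin n → ι) × (Fin n → ι) => A p.1 p.2).FactorsThrough cnt :=
    fun p q h => hfac p q h
  refine ⟨Function.extend cnt (fun p => A p.1 p.2) 0, ?_⟩
  ext i j
  exact hf.extend_apply 0 (i, j)

lemma spec_pow {κ : Type*} [Fintype κ] [DecidableEq κ] (U : Matrix.unitaryGroup κ ℂ) (s : κ → ℝ)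
    (k : ℕ) : spec U s ^ k = spec U fun a => s a ^ k := by
  induction k with
  | zero => simp [spec_one]
  | succ k ih => rw [pow_succ, ih, spec_mul]; simp only [pow_succ]

/-- A permutation invariant Hermitian matrix has polynomially many eigenvalues. -/
lemma PermInv.card_eigenvalues_le {n : ℕ} {A : MatN ι n} (hA : PermInv A)
    {U : Matrix.unitaryGroup (Fin n → ι) ℂ} {s : (Fin n → ι) → ℝ} (hU : A = spec U s) :
    (Finset.univ.image s).card ≤ (n + 1) ^ (Fintype.card ι * Fintype.card ι) := by
  set S := Finset.univ.image s with hS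
  have hli : LinearIndependent ℂ fun k : Fin S.card => A ^ (k : ℕ) := by
    rw [Fintype.linearIndependent_iff]
    intro g hg
    have hinj : Function.Injective fun j : Fin S.card => ((S.equivFin.symm j : ℝ) : ℂ) := by
      intro j j' h
      exact S.equivFin.symm.injective (Subtype.ext (Complex.ofReal_injective h))
    refine congrFun (Matrix.eq_zero_of_forall_index_sum_pow_mul_eq_zero hinj fun j => ?_)
    obtain ⟨a, -, ha⟩ := Finset.mem_image.1 (S.equivFin.symm j).2
    have h1 := congrArg (fun M => (star (U : MatN ι n) * M * (U : MatN ι n)) a a) hg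
    simp only [hU, spec_pow, Matrix.mul_sum, Matrix.sum_mul, Matrix.mul_smul, Matrix.smul_mul,
      star_mul_spec_mul, Matrix.sum_apply, Matrix.smul_apply, Matrix.diagonal_apply_eq, mul_zero,
      zero_mul, Matrix.zero_apply, smul_eq_mul] at h1
    rw [← h1]
    refine Finset.sum_congr rfl fun k _ => ?_
    rw [← ha, mul_comm]
    simp
  calc S.card = Module.finrank ℂ (Submodule.span ℂ (Set.range fun k : Fin S.card => A ^ (k : ℕ))) := by
        rw [finrank_span_eq_card hli, Fintype.card_fin]
    _ ≤ Module.finrank ℂ (LinearMap.range (ofCounts ι n)) := by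
        refine Submodule.finrank_mono (Submodule.span_le.2 ?_)
        rintro _ ⟨k, rfl⟩
        exact (hA.pow k).mem_range
    _ ≤ Module.finrank ℂ ((ι × ι → Fin (n + 1)) → ℂ) := LinearMap.finrank_range_le _
    _ = _ := by simp

end PermutationInvariance

section Mixtures

set_option linter.unusedSectionVars false

variable {ι : Type*} [Fintype ι] [DecidableEq ι]

lemma IsState.norm_apply_le {κ : Type*} [Fintype κ] [DecidableEq κ] {ρ : Matrix κ κ ℂ}
    (hρ : IsState ρ) (i j : κ) : ‖ρ i j‖ ≤ 1 := by
  obtain ⟨V, t, rfl⟩ : ∃ V t, ρ = spec V t := ⟨_, _, exists_spec hρ.1.1⟩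
  have ht : ∀ i, 0 ≤ t i := nonneg_of_spec_posSemidef hρ.1
  have htsum : ∑ i, t i = 1 := by rw [← trace_spec V, hρ.2]; simp
  rw [spec, Matrix.mul_apply, ← htsum]
  refine (norm_sum_le _ _).trans (Finset.sum_le_sum fun a _ => ?_)
  rw [Matrix.mul_diagonal, Matrix.star_apply, norm_mul, norm_mul, norm_star, Complex.norm_real,
    Real.norm_of_nonneg (ht a)]
  have h1 := entry_norm_bound_of_unitary V.2 i a
  have h2 := entry_norm_bound_of_unitary V.2 j a
  calc _ ≤ 1 * t a * 1 := by
        have := ht a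
        gcongr
    _ = t a := by ring

variable {C : Set (MatC ι)} (hC : ∀ σ ∈ C, IsState σ) (μ : Measure ↥C) [IsProbabilityMeasure μ]

include hC in
lemma integrable_tensorPow_apply (n : ℕ) (i j : Fin n → ι) :
    Integrable (fun σ : C => tensorPow (σ : MatC ι) n i j) μ := by
  refine Integrable.of_bound (C := 1) (Measurable.aestronglyMeasurable ?_) (ae_of_all _ fun σ => ?_)
  · have : ∀ a b : ι, Measurable fun σ : C => (σ : MatC ι) a b := fun a b =>
      ((measurable_pi_apply b).comp (measurable_pi_apply (X := fun _ : ι => ι → ℂ) a)).comp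
        measurable_subtype_coe
    exact Finset.measurable_fun_prod _ fun k _ => this _ _
  · exact ((hC σ σ.2).tensorPow n).norm_apply_le i j

include hC in
lemma trace_iidMix_mul (n : ℕ) (X : MatN ι n) :
    (iidMix μ n * X).trace.re = ∫ σ : C, (tensorPow (σ : MatC ι) n * X).trace.re ∂μ := by
  have hi : ∀ i j, Integrable (fun σ : C => tensorPow (σ : MatC ι) n i j * X j i) μ := fun i j =>
    (integrable_tensorPow_apply hC μ n i j).mul_const _
  have h1 : (iidMix μ n * X).trace = ∫ σ : C, (tensorPow (σ : MatC ι) n * X).trace ∂μ := by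
    simp only [Matrix.trace, Matrix.diag_apply, Matrix.mul_apply]
    rw [integral_finsetSum _ fun i _ => integrable_finsetSum _ fun j _ => hi i j]
    refine Finset.sum_congr rfl fun i _ => ?_
    rw [integral_finsetSum _ fun j _ => hi i j]
    refine Finset.sum_congr rfl fun j _ => ?_
    rw [integral_mul_const]
    rfl
  rw [h1]
  refine (integral_re (𝕜 := ℂ) ?_).symm
  simp only [Matrix.trace, Matrix.diag_apply, Matrix.mul_apply]
  exact integrable_finsetSum _ fun i _ => integrable_finsetSum _ fun j _ => hi i j

include hC in
lemma isState_iidMix (n : ℕ) : IsState (iidMix μ n) := by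
  have hH : (iidMix μ n).IsHermitian := by
    ext i j
    rw [Matrix.conjTranspose_apply, Complex.star_def]
    unfold iidMix
    rw [← integral_conj]
    congr 1
    ext σ
    exact congrFun (congrFun ((hC σ σ.2).tensorPow n).1.1 i) j
  constructor
  · rw [exists_spec hH]
    refine spec_posSemidef _ fun a => ?_
    have h1 := trace_mul_spec (iidMix μ n) hH.eigenvectorUnitary (Pi.single a 1)
    have hd : ∀ b, dg (iidMix μ n) hH.eigenvectorUnitary b = hH.eigenvalues b := fun b => by
      rw [← dg_spec_self hH.eigenvectorUnitary hH.eigenvalues, ← exists_spec hH]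
    simp only [hd, Pi.single_apply, mul_ite, mul_one, mul_zero, Finset.sum_ite_eq',
      Finset.mem_univ, if_true] at h1
    rw [← h1, trace_iidMix_mul hC]
    refine integral_nonneg fun σ => trace_mul_re_nonneg ((hC σ σ.2).tensorPow n).1 ?_
    refine spec_posSemidef _ fun b => ?_
    by_cases h : b = a
    · simp [h]
    · simp [h]
  · have h1 := trace_iidMix_mul hC μ n 1
    have h2 := trace_mul_eq_ofReal hH Matrix.isHermitian_one
    rw [h1] at h2
    simp only [mul_one] at h2
    rw [h2]
    have : ∀ σ : C, (tensorPow (σ : MatC ι) n).trace.re = 1 := fun σ => by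
      rw [((hC σ σ.2).tensorPow n).2]; simp
    simp [this]

lemma permInv_iidMix {C : Set (MatC ι)} (μ : Measure ↥C) (n : ℕ) : PermInv (iidMix μ n) := by
  intro π i j
  unfold iidMix
  congr 1
  ext σ
  exact Equiv.prod_comp π fun k => (σ : MatC ι) (i k) (j k)

end Mixtures

section TypeTwoErrors

variable {κ : Type*} [Fintype κ] [DecidableEq κ]

lemma IsState.trace_mul_le_one {σ E : Matrix κ κ ℂ} (hσ : IsState σ) (hE : (1 - E).PosSemidef) :
    (σ * E).trace.re ≤ 1 := by
  have := trace_mul_re_mono hσ.1 hE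
  rwa [mul_one, hσ.2, Complex.one_re] at this

lemma typeII_le {A B : Set (Matrix κ κ ℂ)} (hB : ∀ σ ∈ B, IsState σ) (hBne : B.Nonempty) {ε b : ℝ}
    {E : Matrix κ κ ℂ} (hE : E.PosSemidef) (hE1 : (1 - E).PosSemidef)
    (h1 : ∀ ρ ∈ A, (ρ * (1 - E)).trace.re ≤ ε) (h2 : ∀ σ ∈ B, (σ * E).trace.re ≤ b) :
    typeII A B ε ≤ b := by
  have hle : typeII A B ε ≤ sSup {x : ℝ | ∃ σ ∈ B, x = (σ * E).trace.re} :=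
    csInf_le ⟨0, ?_⟩ ⟨E, hE, hE1, h1, rfl⟩
  · refine hle.trans (csSup_le ?_ ?_)
    · obtain ⟨σ, hσ⟩ := hBne
      exact ⟨_, σ, hσ, rfl⟩
    · rintro _ ⟨σ, hσ, rfl⟩
      exact h2 σ hσ
  · rintro _ ⟨F, hF, -, -, rfl⟩
    refine Real.sSup_nonneg ?_
    rintro _ ⟨σ, hσ, rfl⟩
    exact trace_mul_re_nonneg (hB σ hσ).1 hF

lemma le_typeII {A B : Set (Matrix κ κ ℂ)} (hB : ∀ σ ∈ B, IsState σ) {ε b : ℝ} (hε : 0 ≤ ε)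
    (h : ∀ E : Matrix κ κ ℂ, E.PosSemidef → (1 - E).PosSemidef →
      (∀ ρ ∈ A, (ρ * (1 - E)).trace.re ≤ ε) → ∀ c, (∀ σ ∈ B, (σ * E).trace.re ≤ c) → b ≤ c) :
    b ≤ typeII A B ε := by
  refine le_csInf ⟨_, 1, Matrix.PosSemidef.one, ?_, fun ρ _ => ?_, rfl⟩ ?_
  · rw [sub_self]; exact Matrix.PosSemidef.zero
  · simpa using hε
  · rintro _ ⟨E, hE, hE1, h1, rfl⟩
    refine h E hE hE1 h1 _ fun σ hσ => le_csSup ⟨1, ?_⟩ ⟨σ, hσ, rfl⟩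
    rintro _ ⟨τ, hτ, rfl⟩
    exact (hB τ hτ).trace_mul_le_one hE1

lemma negLog_anti {x y : ℝ} (h : x ≤ y) : negLog y ≤ negLog x := by
  unfold negLog
  split_ifs with h1 h2 h2
  · exact le_rfl
  · exact absurd (h.trans h1) h2
  · exact le_top
  · rw [EReal.coe_le_coe_iff]
    exact neg_le_neg (Real.log_le_log (not_le.1 h2) h)

lemma cFrac_mul_coe (n : ℕ) (x : ℝ) : cFrac n * (x : EReal) = ((x / n : ℝ) : EReal) := by
  rw [cFrac, ← EReal.coe_mul, div_eq_inv_mul]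

lemma cFrac_mul_mono (n : ℕ) {x y : EReal} (h : x ≤ y) : cFrac n * x ≤ cFrac n * y :=
  mul_le_mul_of_nonneg_left h (by rw [cFrac]; exact_mod_cast inv_nonneg.2 n.cast_nonneg)

lemma le_of_cFrac_mul_le {n : ℕ} (hn : 0 < n) {x : EReal} {L : ℝ}
    (h : cFrac n * x ≤ (L : EReal)) : x ≤ ((n * L : ℝ) : EReal) := by
  have hn' : (0 : ℝ) < n := by exact_mod_cast hn
  induction x with
  | bot => exact bot_le
  | top =>
    rw [cFrac, EReal.coe_mul_top_of_pos (inv_pos.2 hn')] at h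
    exact absurd (top_le_iff.1 h) (EReal.coe_ne_top L)
  | coe r =>
    rw [cFrac_mul_coe, EReal.coe_le_coe_iff, div_le_iff₀ hn'] at h
    rw [EReal.coe_le_coe_iff]
    linarith

lemma neg_one_le_of_relEnt_le {ρ σ : Matrix κ κ ℂ} (hρ : IsState ρ) (hσ : IsState σ) {D : ℝ}
    (h : relEnt ρ σ ≤ (D : EReal)) : -1 ≤ D := by
  by_contra hD
  push Not at hD
  have h1 := half_le_add_exp_mul_trace hρ hσ h (a := (-1 - D) / 2) (ε := 1) (E := 0) (by linarith)
    Matrix.PosSemidef.zero (by rw [sub_zero]; exact Matrix.PosSemidef.one)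
    (by rw [sub_zero, mul_one, hρ.2, Complex.one_re])
  have h2 : (D + 1) / ((-1 - D) / 2) = -2 := by
    have : (-1 - D) ≠ 0 := by linarith
    field_simp
    ring
  rw [h2] at h1
  simp at h1
  linarith

end TypeTwoErrors

section Converse

variable {ι : Type*} [Fintype ι] [DecidableEq ι]

lemma iidSet_isState {C : Set (MatC ι)} (hC : ∀ σ ∈ C, IsState σ) (n : ℕ) :
    ∀ σ ∈ iidSet C n, IsState σ := by
  rintro _ ⟨σ, hσ, rfl⟩
  exact (hC σ hσ).tensorPow n

lemma trace_iidMix_mul_le {C : Set (MatC ι)} (hC : ∀ σ ∈ C, IsState σ) (μ : Measure ↥C)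
    [IsProbabilityMeasure μ] {n : ℕ} {E : MatN ι n} (hE : E.PosSemidef) {c : ℝ}
    (h : ∀ σ ∈ iidSet C n, (σ * E).trace.re ≤ c) : (iidMix μ n * E).trace.re ≤ c := by
  rw [trace_iidMix_mul hC]
  calc _ ≤ ∫ _ : C, c ∂μ := integral_mono_of_nonneg
        (ae_of_all _ fun σ => trace_mul_re_nonneg ((hC σ σ.2).tensorPow n).1 hE)
        (integrable_const c) (ae_of_all _ fun σ => h _ ⟨σ, σ.2, rfl⟩)
    _ = c := by simp

lemma steinExponent_le_of_frequently {A B : Set (MatC ι)} (hA : ∀ ρ ∈ A, IsState ρ)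
    (hB : ∀ σ ∈ B, IsState σ) {ρ : MatC ι} (hρ : ρ ∈ A) (μ : Measure ↥B) [IsProbabilityMeasure μ]
    {L : ℝ} (h : ∃ᶠ n in atTop, cFrac n * relEnt (tensorPow ρ n) (iidMix μ n) ≤ (L : EReal)) :
    steinExponent (iidSet A) (iidSet B) ≤ (L : EReal) := by
  have hst := fun n => (hA ρ hρ).tensorPow n
  have hD : ∃ᶠ n : ℕ in atTop,
      relEnt (tensorPow ρ n) (iidMix μ n) ≤ ((n * L : ℝ) : EReal) :=
    (h.and_eventually (eventually_gt_atTop 0)).mono fun n hn => le_of_cFrac_mul_le hn.2 hn.1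
  have hL : 0 ≤ L := by
    by_contra hL
    push Not at hL
    obtain ⟨N, hN⟩ := exists_nat_gt (1 / (-L))
    obtain ⟨n, hn, hnN⟩ := (hD.and_eventually (eventually_ge_atTop N)).exists
    have h1 := neg_one_le_of_relEnt_le (hst n) (isState_iidMix hB μ n) hn
    have h2 : (N : ℝ) ≤ n := by exact_mod_cast hnN
    rw [div_lt_iff₀ (by linarith)] at hN
    nlinarith
  refine EReal.le_of_forall_lt_iff_le.1 fun z hz => ?_
  rw [EReal.coe_lt_coe_iff] at hz
  set η : ℝ := (z - L) / 2 with hη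
  have hη0 : 0 < η := by rw [hη]; linarith
  set M : ℝ := L + η with hM
  have hM0 : 0 < M := by linarith
  set ε : ℝ := η / (8 * M) with hε
  have hε0 : 0 < ε := by positivity
  have hε1 : ε < 1 := by rw [hε, div_lt_one (by positivity)]; linarith
  refine (iInf₂_le ε ⟨hε0, hε1⟩).trans (liminf_le_of_frequently_le ?_)
  obtain ⟨N1, hN1⟩ := exists_nat_gt (2 / η)
  obtain ⟨N2, hN2⟩ := exists_nat_gt (-Real.log ε / η)
  refine (hD.and_eventually ((eventually_ge_atTop N1).and ((eventually_ge_atTop N2).and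
    (eventually_gt_atTop 0)))).mono ?_
  rintro n ⟨hn, hnN1, hnN2, hn0⟩
  have hn0' : (0 : ℝ) < n := by exact_mod_cast hn0
  have hn1 : 2 ≤ n * η := by
    rw [div_lt_iff₀ hη0] at hN1
    have : (N1 : ℝ) ≤ n := by exact_mod_cast hnN1
    nlinarith
  have hn2 : -Real.log ε ≤ n * η := by
    rw [div_lt_iff₀ hη0] at hN2
    have : (N2 : ℝ) ≤ n := by exact_mod_cast hnN2
    nlinarith
  have key : ε * Real.exp (-(n * M)) ≤ typeII (iidSet A n) (iidSet B n) ε := by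
    refine le_typeII (iidSet_isState hB n) hε0.le fun E hE hE1 hI c hc => ?_
    have h1 := half_le_add_exp_mul_trace (hst n) (isState_iidMix hB μ n) hn
      (a := n * M) (by positivity) hE hE1 (hI _ ⟨ρ, hρ, rfl⟩)
    have h2 := trace_iidMix_mul_le hB μ hE hc
    have h3 : 2 * ε ≤ (1 - (n * L + 1) / (n * M)) / 2 := by
      have : (1 - (n * L + 1) / (n * M)) / 2 - 2 * ε = (n * η - 2) / (4 * (n * M)) := by
        rw [hε]
        field_simp
        rw [hM]
        ring
      have : 0 ≤ (n * η - 2) / (4 * (n * M)) := div_nonneg (by linarith) (by positivity)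
      linarith
    have h4 : ε ≤ Real.exp (n * M) * c := by
      have := mul_le_mul_of_nonneg_left h2 (Real.exp_pos (n * M)).le
      linarith
    calc ε * Real.exp (-(n * M)) ≤ Real.exp (n * M) * c * Real.exp (-(n * M)) :=
          mul_le_mul_of_nonneg_right h4 (Real.exp_pos _).le
      _ = c * (Real.exp (n * M) * Real.exp (-(n * M))) := by ring
      _ = c := by rw [← Real.exp_add]; simp
  refine (cFrac_mul_mono n (negLog_anti key)).trans ?_
  rw [negLog, if_neg (not_le.2 (by positivity)), cFrac_mul_coe, EReal.coe_le_coe_iff,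
    div_le_iff₀ hn0', Real.log_mul hε0.ne' (Real.exp_pos _).ne', Real.log_exp]
  have : z = M + η := by rw [hM, hη]; ring
  rw [this]
  linarith

end Converse

section Achievability

set_option linter.unusedSectionVars false

variable {ι : Type*} [Fintype ι] [DecidableEq ι]

/-- A positive definite `k`-copy observable separating `ρ^{⊗k}` from all `σ^{⊗k}`, `σ ∈ B`, in a
Chernoff-type sense with exponent `R`. -/
def HasWitness (B : Set (MatC ι)) (R : ℝ) (ρ : MatC ι) : Prop :=
  ∃ k : ℕ, 0 < k ∧ ∃ s : ℝ, 0 < s ∧ s ≤ 1 ∧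
    ∃ (U : Matrix.unitaryGroup (Fin k → ι) ℂ) (x : (Fin k → ι) → ℝ), (∀ a, 0 < x a) ∧
      (∀ σ ∈ B, (tensorPow σ k * spec U x).trace.re ≤ 1) ∧
      Real.exp (s * (k * R)) * (tensorPow ρ k * spec U (fun a => x a ^ (-s))).trace.re < 1

lemma continuous_trace_tensorPow_mul (k : ℕ) (X : MatN ι k) :
    Continuous fun ρ : MatC ι => (tensorPow ρ k * X).trace.re := by
  refine Complex.continuous_re.comp (Continuous.matrix_trace (Continuous.mul ?_ continuous_const))
  refine continuous_pi fun i => continuous_pi fun j => ?_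
  exact continuous_finsetProd _ fun t _ => (continuous_apply_apply (i t) (j t))

lemma isOpen_hasWitness (B : Set (MatC ι)) (R : ℝ) : IsOpen {ρ | HasWitness B R ρ} := by
  refine isOpen_iff_eventually.2 ?_
  rintro ρ ⟨k, hk, s, hs0, hs1, U, x, hx, hB, hlt⟩
  have hc : Continuous fun ρ : MatC ι => Real.exp (s * (k * R)) *
      (tensorPow ρ k * spec U (fun a => x a ^ (-s))).trace.re :=
    continuous_const.mul (continuous_trace_tensorPow_mul k _)
  filter_upwards [hc.continuousAt.eventually_lt continuousAt_const hlt] with ρ' h'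
  exact ⟨k, hk, s, hs0, hs1, U, x, hx, hB, h'⟩

lemma HasWitness.anti {B : Set (MatC ι)} {R R' : ℝ} (hR : R ≤ R') {ρ : MatC ι} (hρ : IsState ρ)
    (h : HasWitness B R' ρ) : HasWitness B R ρ := by
  obtain ⟨k, hk, s, hs0, hs1, U, x, hx, hB, hlt⟩ := h
  refine ⟨k, hk, s, hs0, hs1, U, x, hx, hB, lt_of_le_of_lt ?_ hlt⟩
  refine mul_le_mul_of_nonneg_right (Real.exp_le_exp.2 ?_)
    (trace_mul_re_nonneg (hρ.tensorPow k).1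
      (spec_posSemidef U fun a => (Real.rpow_pos_of_pos (hx a) _).le))
  gcongr

lemma hasWitness_of_lt {B : Set (MatC ι)} {R : ℝ} {ρ : MatC ι} (hρ : IsState ρ) {n : ℕ}
    (hn : 0 < n) (U : Matrix.unitaryGroup (Fin n → ι) ℂ) {x : (Fin n → ι) → ℝ} (hx : ∀ a, 0 < x a)
    (hB : ∀ σ ∈ B, (tensorPow σ n * spec U x).trace.re ≤ 1)
    (h : n * R < (tensorPow ρ n * spec U (fun a => Real.log (x a))).trace.re) :
    HasWitness B R ρ := by
  set p : (Fin n → ι) → ℝ := dg (tensorPow ρ n) U with hp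
  have hd : HasDerivAt (fun s : ℝ => Real.exp (s * (n * R)) * ∑ a, p a * x a ^ (-s))
      (n * R - ∑ a, p a * Real.log (x a)) 0 := by
    have h1 : HasDerivAt (fun s : ℝ => Real.exp (s * (n * R))) (n * R) 0 := by
      simpa using ((hasDerivAt_id (0 : ℝ)).mul_const (n * R)).exp
    have h2 : HasDerivAt (fun s : ℝ => ∑ a, p a * x a ^ (-s))
        (∑ a, p a * -Real.log (x a)) 0 := by
      refine HasDerivAt.fun_sum fun a _ => HasDerivAt.const_mul _ ?_
      simpa using (hasDerivAt_neg (0 : ℝ)).const_rpow (hx a)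
    have h3 := h1.mul h2
    have h4 : ∑ a, p a = 1 := by
      rw [hp, sum_dg, ((hρ.tensorPow n)).2, Complex.one_re]
    have h5 : Real.exp (0 * (n * R)) = 1 := by simp
    have h6 : ∑ a, p a * x a ^ (-(0 : ℝ)) = 1 := by simpa using h4
    rw [h5, h6, mul_one, one_mul] at h3
    simp only [mul_neg, Finset.sum_neg_distrib, ← sub_eq_add_neg] at h3
    exact h3
  rw [trace_mul_spec] at h
  have h7 := hd.tendsto_slope_zero_right.eventually_lt_const (u := 0) (by linarith)
  have h8 : ∀ᶠ s : ℝ in 𝓝[>] 0, s ≤ 1 :=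
    nhdsWithin_le_nhds (eventually_le_nhds one_pos)
  obtain ⟨s, ⟨hs, hs1⟩, hs0⟩ := ((h7.and h8).and self_mem_nhdsWithin).exists
  have hs0 : 0 < s := hs0
  refine ⟨n, hn, s, hs0, hs1, U, x, hx, hB, ?_⟩
  rw [trace_mul_spec]
  have h9 : ∑ a, p a = 1 := by
    rw [hp, sum_dg, ((hρ.tensorPow n)).2, Complex.one_re]
  simp only [zero_add, zero_mul, Real.exp_zero, neg_zero, Real.rpow_zero, mul_one, h9,
    smul_eq_mul] at hs
  exact sub_neg.1 (neg_of_mul_neg_right hs (inv_nonneg.2 hs0.le))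

lemma exists_uniform_witness {A B : Set (MatC ι)} (hA : ∀ ρ ∈ A, IsState ρ)
    (hB : ∀ σ ∈ B, IsState σ) (hc : IsCompact A) {R : ℝ} (h : ∀ ρ ∈ A, HasWitness B R ρ) :
    ∃ (r : ℝ) (δ : ℕ → ℝ), 0 ≤ r ∧ Tendsto δ atTop (𝓝 0) ∧ (∀ n, 0 ≤ δ n) ∧
      ∀ n, ∃ W : MatN ι n, W.PosSemidef ∧ (∀ σ ∈ B, (tensorPow σ n * W).trace.re ≤ r) ∧
        ∀ ρ ∈ A, ∃ (U : Matrix.unitaryGroup (Fin n → ι) ℂ) (x : (Fin n → ι) → ℝ),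
          (∀ a, 0 < x a) ∧ (W - spec U x).PosSemidef ∧ ∃ s : ℝ, 0 ≤ s ∧ s ≤ 1 ∧
            Real.exp (s * (n * R)) * (tensorPow ρ n * spec U (fun a => x a ^ (-s))).trace.re
              ≤ δ n := by
  refine hc.induction_on (p := fun T => ∃ (r : ℝ) (δ : ℕ → ℝ), 0 ≤ r ∧ Tendsto δ atTop (𝓝 0) ∧
    (∀ n, 0 ≤ δ n) ∧
      ∀ n, ∃ W : MatN ι n, W.PosSemidef ∧ (∀ σ ∈ B, (tensorPow σ n * W).trace.re ≤ r) ∧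
        ∀ ρ ∈ T, ∃ (U : Matrix.unitaryGroup (Fin n → ι) ℂ) (x : (Fin n → ι) → ℝ),
          (∀ a, 0 < x a) ∧ (W - spec U x).PosSemidef ∧ ∃ s : ℝ, 0 ≤ s ∧ s ≤ 1 ∧
            Real.exp (s * (n * R)) * (tensorPow ρ n * spec U (fun a => x a ^ (-s))).trace.re
              ≤ δ n) ?_ ?_ ?_ ?_
  · exact ⟨0, fun _ => 0, le_rfl, tendsto_const_nhds, fun _ => le_rfl, fun n =>
      ⟨0, Matrix.PosSemidef.zero, fun σ _ => by simp, fun ρ hρ => absurd hρ (Set.notMem_empty _)⟩⟩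
  · rintro T T' hTT ⟨r, δ, hr, hδ, hδ0, h⟩
    refine ⟨r, δ, hr, hδ, hδ0, fun n => ?_⟩
    obtain ⟨W, hW, h1, h2⟩ := h n
    exact ⟨W, hW, h1, fun ρ hρ => h2 ρ (hTT hρ)⟩
  · rintro T T' ⟨r, δ, hr, hδ, hδ0, h⟩ ⟨r', δ', hr', hδ', hδ0', h'⟩
    refine ⟨r + r', fun n => δ n + δ' n, add_nonneg hr hr', by simpa using hδ.add hδ',
      fun n => add_nonneg (hδ0 n) (hδ0' n), fun n => ?_⟩
    obtain ⟨W, hW, h1, h2⟩ := h n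
    obtain ⟨W', hW', h1', h2'⟩ := h' n
    refine ⟨W + W', hW.add hW', fun σ hσ => ?_, ?_⟩
    · rw [mul_add, Matrix.trace_add, Complex.add_re]
      exact add_le_add (h1 σ hσ) (h1' σ hσ)
    · rintro ρ (hρ | hρ)
      · obtain ⟨U, x, hx, hWx, s, hs0, hs1, hs⟩ := h2 ρ hρ
        refine ⟨U, x, hx, ?_, s, hs0, hs1, hs.trans (by linarith [hδ0' n])⟩
        rw [add_sub_right_comm]
        exact hWx.add hW'
      · obtain ⟨U, x, hx, hWx, s, hs0, hs1, hs⟩ := h2' ρ hρ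
        refine ⟨U, x, hx, ?_, s, hs0, hs1, hs.trans (by linarith [hδ0 n])⟩
        rw [add_sub_assoc]
        exact hW.add hWx
  · intro ρ hρ
    obtain ⟨k, hk, s, hs0, hs1, U, x, hx, hBx, hlt⟩ := h ρ hρ
    obtain ⟨q, hq, hq1⟩ := exists_between hlt
    have hτ : ∀ ρ : MatC ι, IsState ρ →
        0 ≤ (tensorPow ρ k * spec U (fun a => x a ^ (-s))).trace.re := fun ρ hρ =>
      trace_mul_re_nonneg (hρ.tensorPow k).1
        (spec_posSemidef U fun a => (Real.rpow_pos_of_pos (hx a) _).le)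
    have hq0 : 0 ≤ q := (mul_nonneg (Real.exp_pos _).le (hτ ρ (hA ρ hρ))).trans hq.le
    have hcont : Continuous fun ρ : MatC ι => Real.exp (s * (k * R)) *
        (tensorPow ρ k * spec U (fun a => x a ^ (-s))).trace.re :=
      continuous_const.mul (continuous_trace_tensorPow_mul k _)
    refine ⟨{ρ | IsState ρ ∧ Real.exp (s * (k * R)) *
      (tensorPow ρ k * spec U (fun a => x a ^ (-s))).trace.re < q}, ?_, 1,
      fun n => Real.exp (s * (k * |R|)) * q ^ (n / k), zero_le_one, ?_,
      fun n => mul_nonneg (Real.exp_pos _).le (pow_nonneg hq0 _), fun n => ?_⟩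
    · filter_upwards [nhdsWithin_le_nhds
        (hcont.continuousAt.eventually_lt continuousAt_const hq), self_mem_nhdsWithin] with ρ' h1 h2
      exact ⟨hA ρ' h2, h1⟩
    · have := ((tendsto_pow_atTop_nhds_zero_of_lt_one hq0 hq1).comp
        (Nat.tendsto_div_const_atTop hk.ne')).const_mul (Real.exp (s * (k * |R|)))
      simpa using this
    · obtain ⟨V, y, hy, hVy⟩ := exists_block_pow hk U hx n
      refine ⟨spec V y, spec_posSemidef V fun a => (hy a).le, fun σ hσ => ?_, ?_⟩
      · have h1 := hVy σ (hB σ hσ) 1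
        simp only [Real.rpow_one] at h1
        rw [h1]
        exact pow_le_one₀ (trace_mul_re_nonneg ((hB σ hσ).tensorPow k).1
          (spec_posSemidef U fun a => (hx a).le)) (hBx σ hσ)
      · rintro ρ' ⟨h1, h2⟩
        refine ⟨V, y, hy, by rw [sub_self]; exact Matrix.PosSemidef.zero, s, hs0.le, hs1, ?_⟩
        rw [hVy ρ' h1]
        have h3 : Real.exp (s * (n * R)) ≤
            Real.exp (s * (k * |R|)) * Real.exp (s * (k * R)) ^ (n / k) := by
          rw [← Real.exp_nat_mul, ← Real.exp_add, Real.exp_le_exp]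
          have h4 : (n : ℝ) = k * (n / k : ℕ) + (n % k : ℕ) := by
            exact_mod_cast (Nat.div_add_mod n k).symm
          have h5 : ((n % k : ℕ) : ℝ) * R ≤ k * |R| := by
            have h6 : ((n % k : ℕ) : ℝ) ≤ k := by exact_mod_cast (Nat.mod_lt n hk).le
            calc ((n % k : ℕ) : ℝ) * R ≤ (n % k : ℕ) * |R| := by gcongr; exact le_abs_self R
              _ ≤ _ := by gcongr
          rw [h4]
          have := mul_le_mul_of_nonneg_left h5 hs0.le
          linarith
        calc _ ≤ Real.exp (s * (k * |R|)) * Real.exp (s * (k * R)) ^ (n / k) *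
              (tensorPow ρ' k * spec U fun a => x a ^ (-s)).trace.re ^ (n / k) :=
              mul_le_mul_of_nonneg_right h3 (pow_nonneg (hτ ρ' h1) _)
          _ = Real.exp (s * (k * |R|)) * (Real.exp (s * (k * R)) *
              (tensorPow ρ' k * spec U fun a => x a ^ (-s)).trace.re) ^ (n / k) := by
              rw [mul_pow, mul_assoc]
          _ ≤ _ := by
              have := mul_nonneg (Real.exp_pos (s * (k * R))).le (hτ ρ' h1)
              exact mul_le_mul_of_nonneg_left (pow_le_pow_left₀ this h2.le _) (Real.exp_pos _).le

lemma le_steinExponent {A B : Set (MatC ι)} (hA : ∀ ρ ∈ A, IsState ρ)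
    (hB : ∀ σ ∈ B, IsState σ) (hBne : B.Nonempty) (hc : IsCompact A) {R : ℝ}
    (h : ∀ ρ ∈ A, HasWitness B R ρ) : (R : EReal) ≤ steinExponent (iidSet A) (iidSet B) := by
  obtain ⟨r, δ, hr, hδ, -, hW⟩ := exists_uniform_witness hA hB hc h
  refine le_iInf₂ fun ε hε => EReal.ge_of_forall_gt_iff_ge.1 fun z hz => ?_
  rw [EReal.coe_lt_coe_iff] at hz
  have hlim : Tendsto (fun n : ℕ => R - Real.log (r + 1) / n) atTop (𝓝 R) := by
    simpa using tendsto_const_nhds.sub (tendsto_const_div_atTop_nhds_zero_nat (Real.log (r + 1)))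
  refine le_liminf_of_le (by isBoundedDefault) ?_
  filter_upwards [hδ.eventually_le_const hε.1, hlim.eventually_const_le hz,
    eventually_gt_atTop 0] with n hn1 hn2 hn0
  have hn0' : (0 : ℝ) < n := by exact_mod_cast hn0
  obtain ⟨W, hWp, h1, h2⟩ := hW n
  obtain ⟨E, hE, hE1, h3, h4⟩ := exists_soft_test hWp (Real.exp_pos (n * R))
  have key : typeII (iidSet A n) (iidSet B n) ε ≤ (r + 1) * Real.exp (-(n * R)) := by
    refine typeII_le (iidSet_isState hB n) ?_ hE hE1 ?_ ?_
    · obtain ⟨σ, hσ⟩ := hBne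
      exact ⟨_, σ, hσ, rfl⟩
    · rintro _ ⟨ρ, hρ, rfl⟩
      obtain ⟨U, x, hx, hWx, s, hs0, hs1, hs⟩ := h2 ρ hρ
      refine (h4 U x hx hWx s hs0 hs1 _ ((hA ρ hρ).tensorPow n).1).trans ?_
      rw [← Real.exp_mul, mul_comm _ s]
      exact hs.trans hn1
    · rintro _ ⟨σ, hσ, rfl⟩
      refine (h3 _ ((hB σ hσ).tensorPow n).1).trans ?_
      rw [Real.exp_neg, ← div_eq_mul_inv]
      have := h1 σ hσ
      gcongr
      linarith
  refine le_trans ?_ (cFrac_mul_mono n (negLog_anti key))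
  rw [negLog, if_neg (not_le.2 (by positivity)), cFrac_mul_coe, EReal.coe_le_coe_iff,
    Real.log_mul (by positivity) (Real.exp_pos _).ne', Real.log_exp]
  refine hn2.trans (le_of_eq ?_)
  field_simp
  ring

lemma exists_not_hasWitness {A B : Set (MatC ι)} (hA : ∀ ρ ∈ A, IsState ρ)
    (hB : ∀ σ ∈ B, IsState σ) (hBne : B.Nonempty) (hc : IsCompact A) {S : ℝ}
    (hS : steinExponent (iidSet A) (iidSet B) = S) :
    ∃ ρ ∈ A, ∀ R : ℝ, S < R → ¬ HasWitness B R ρ := by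
  have hne' : ∀ R : Set.Ioi S, (A ∩ {ρ | ¬ HasWitness B R ρ}).Nonempty := by
    rintro ⟨R, hR : S < R⟩
    by_contra hcon
    have := le_steinExponent hA hB hBne hc (R := R) fun ρ hρ => by
      by_contra hρ'
      exact hcon ⟨ρ, hρ, hρ'⟩
    rw [hS, EReal.coe_le_coe_iff] at this
    linarith
  have hcl : ∀ R : ℝ, IsClosed {ρ | ¬ HasWitness B R ρ} := fun R =>
    (isOpen_hasWitness B R).isClosed_compl
  have : Nonempty (Set.Ioi S) := ⟨⟨S + 1, by simp⟩⟩
  obtain ⟨ρ, hρ⟩ := IsCompact.nonempty_iInter_of_directed_nonempty_isCompact_isClosed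
    (fun R : Set.Ioi S => A ∩ {ρ | ¬ HasWitness B R ρ}) (fun R R' =>
      ⟨⟨min R R', Set.mem_Ioi.2 (lt_min R.2 R'.2)⟩,
        fun ρ hρ => ⟨hρ.1, fun hw => hρ.2 (hw.anti (min_le_left _ _) (hA ρ hρ.1))⟩,
        fun ρ hρ => ⟨hρ.1, fun hw => hρ.2 (hw.anti (min_le_right _ _) (hA ρ hρ.1))⟩⟩) hne'
    (fun R => hc.inter_right (hcl R)) (fun R => hc.isClosed.inter (hcl R))
  rw [Set.mem_iInter] at hρ
  exact ⟨ρ, (hρ (Classical.arbitrary _)).1, fun R hR => (hρ ⟨R, hR⟩).2⟩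

lemma isCompact_of_isState {C : Set (MatC ι)} (hC : ∀ σ ∈ C, IsState σ) (h : IsClosed C) :
    IsCompact C := by
  have : IsCompact (Set.pi Set.univ fun _ : ι => Set.pi Set.univ fun _ : ι =>
      Metric.closedBall (0 : ℂ) 1) :=
    isCompact_univ_pi fun _ => isCompact_univ_pi fun _ => isCompact_closedBall _ _
  refine this.of_isClosed_subset h fun σ hσ i _ j _ => ?_
  rw [mem_closedBall_zero_iff]
  exact (hC σ hσ).norm_apply_le i j

end Achievability

section LogConcavity

open scoped Matrix.Norms.L2Operator MatrixOrder

variable {κ : Type*} [Fintype κ] [DecidableEq κ]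

lemma matLog_eq_log {A : Matrix κ κ ℂ} (hA : A.IsHermitian) : matLog A = CFC.log A := by
  rw [CFC.log]
  have hA' : IsSelfAdjoint A := hA
  have := cfcHom_eq_of_continuous_of_map_id hA' hA.cfcAux hA.isClosedEmbedding_cfcAux.continuous
    hA.cfcAux_id
  rw [cfc_apply Real.log A hA' (by rw [continuousOn_iff_continuous_domRestrict]; fun_prop), this,
    matLog, dif_pos hA]
  rfl

lemma concaveOn_matLog : ConcaveOn ℝ {A : Matrix κ κ ℂ | A.PosDef} matLog := by
  have h := (CFC.concaveOn_log (A := Matrix κ κ ℂ))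
  simp only [Matrix.isStrictlyPositive_iff_posDef] at h
  exact h.congr fun A hA => (matLog_eq_log hA.isHermitian).symm

lemma concaveOn_trace_mul_matLog {ρ : Matrix κ κ ℂ} (hρ : ρ.PosSemidef) :
    ConcaveOn ℝ {A : Matrix κ κ ℂ | A.PosDef} fun A => (ρ * matLog A).trace.re := by
  refine ⟨concaveOn_matLog.1, fun A hA B hB a b ha hb hab => ?_⟩
  have h := Matrix.le_iff.1 (concaveOn_matLog.2 hA hB ha hb hab)
  have h2 := trace_mul_re_mono hρ h
  simpa [mul_add, Matrix.trace_add] using h2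

end LogConcavity

section Minimax

set_option linter.unusedSectionVars false

variable {κ : Type*} [Fintype κ] [DecidableEq κ]

lemma trace_mul_re_pos {ρ ω : Matrix κ κ ℂ} (hρ : IsState ρ) (hω : ω.PosDef) :
    0 < (ρ * ω).trace.re := by
  rw [exists_spec hω.isHermitian, trace_mul_spec]
  have h1 : ∑ a, dg ρ hω.isHermitian.eigenvectorUnitary a = 1 := by
    rw [sum_dg, hρ.2, Complex.one_re]
  have h0 := fun a => dg_nonneg hρ.1 hω.isHermitian.eigenvectorUnitary a
  have hpos : ∃ a, 0 < dg ρ hω.isHermitian.eigenvectorUnitary a := by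
    by_contra hcon
    push Not at hcon
    have := Finset.sum_nonpos fun a (_ : a ∈ Finset.univ) => hcon a
    linarith
  obtain ⟨a, ha⟩ := hpos
  exact Finset.sum_pos' (fun a _ => mul_nonneg (h0 a) (hω.eigenvalues_pos a).le)
    ⟨a, Finset.mem_univ a, mul_pos ha (hω.eigenvalues_pos a)⟩

lemma trace_mul_matLog_smul {ρ ω : Matrix κ κ ℂ} (hρ : IsState ρ) (hω : ω.PosDef) {r : ℝ}
    (hr : 0 < r) :
    (ρ * matLog ((r : ℂ) • ω)).trace.re = Real.log r + (ρ * matLog ω).trace.re := by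
  have hpos := hω.eigenvalues_pos
  rw [exists_spec hω.isHermitian, smul_spec, matLog_spec, matLog_spec, trace_mul_spec,
    trace_mul_spec]
  have h1 : ∑ a, dg ρ hω.isHermitian.eigenvectorUnitary a = 1 := by
    rw [sum_dg, hρ.2, Complex.one_re]
  calc _ = ∑ a, (dg ρ hω.isHermitian.eigenvectorUnitary a * Real.log r +
        dg ρ hω.isHermitian.eigenvectorUnitary a *
          Real.log (hω.isHermitian.eigenvalues a)) := by
        refine Finset.sum_congr rfl fun a _ => ?_
        rw [Real.log_mul hr.ne' (hpos a).ne', mul_add]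
    _ = _ := by rw [Finset.sum_add_distrib, ← Finset.sum_mul, h1, one_mul]

lemma re_trace_smul_mul (r : ℝ) (A B : Matrix κ κ ℂ) :
    (A * ((r : ℂ) • B)).trace.re = r * (A * B).trace.re := by
  rw [Matrix.mul_smul, Matrix.trace_smul, smul_eq_mul, Complex.re_ofReal_mul]

lemma continuous_re_trace_mul (ω : Matrix κ κ ℂ) :
    Continuous fun σ : Matrix κ κ ℂ => (σ * ω).trace.re :=
  Complex.continuous_re.comp (Continuous.matrix_trace (Continuous.mul continuous_id continuous_const))

lemma exists_posDef_forall_lt {ρ : Matrix κ κ ℂ} (hρ : IsState ρ) {K : Set (Matrix κ κ ℂ)}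
    (hne : K.Nonempty) (hconv : Convex ℝ K) (hcomp : IsCompact K) {t : ℝ}
    (h : ∀ σ ∈ K, ∃ ω : Matrix κ κ ℂ, ω.PosDef ∧ t < (ρ * matLog ω).trace.re - (σ * ω).trace.re) :
    ∃ ω : Matrix κ κ ℂ, ω.PosDef ∧
      ∀ σ ∈ K, t < (ρ * matLog ω).trace.re - (σ * ω).trace.re := by
  choose! w hw hwt using h
  obtain ⟨T, hTK, hT⟩ := hcomp.elim_nhds_subcover
    (fun σ => {τ | t < (ρ * matLog (w σ)).trace.re - (τ * w σ).trace.re}) fun σ hσ =>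
    (isOpen_lt continuous_const
      (continuous_const.sub (continuous_re_trace_mul (w σ)))).mem_nhds (hwt σ hσ)
  set c : T → ℝ := fun i => (ρ * matLog (w i)).trace.re with hc
  set f : Matrix κ κ ℂ → (T → ℝ) → ℝ := fun σ p => ∑ i, p i * (c i - (σ * w i).trace.re) with hf
  have hfσ : ∀ p, Continuous fun σ => f σ p := fun p =>
    continuous_finsetSum _ fun i _ =>
      continuous_const.mul (continuous_const.sub (continuous_re_trace_mul _))
  have hfp : ∀ σ, Continuous fun p => f σ p := fun σ =>
    continuous_finsetSum _ fun i _ => (continuous_apply i).mul continuous_const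
  have haff : ∀ p ∈ stdSimplex ℝ T, ∀ (σ τ : Matrix κ κ ℂ) (a b : ℝ), a + b = 1 →
      f (a • σ + b • τ) p = a • f σ p + b • f τ p := by
    intro p _ σ τ a b hab
    simp only [hf, smul_eq_mul, Finset.mul_sum, ← Finset.sum_add_distrib]
    refine Finset.sum_congr rfl fun i _ => ?_
    rw [add_mul, smul_mul_assoc, smul_mul_assoc, Matrix.trace_add, Matrix.trace_smul,
      Matrix.trace_smul, Complex.add_re, Complex.smul_re, Complex.smul_re, smul_eq_mul, smul_eq_mul]
    linear_combination (p i * c i) * (-hab)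
  have hlin : ∀ (σ : Matrix κ κ ℂ) (p q : T → ℝ) (a b : ℝ),
      f σ (a • p + b • q) = a • f σ p + b • f σ q := by
    intro σ p q a b
    simp only [hf, smul_eq_mul, Finset.mul_sum, ← Finset.sum_add_distrib]
    refine Finset.sum_congr rfl fun i _ => ?_
    simp only [Pi.add_apply, Pi.smul_apply, smul_eq_mul]
    ring
  obtain ⟨p, hp, hpt⟩ := Sion.exists_lt_iInf_of_lt_iInf_of_finite (X := K) (Y := stdSimplex ℝ T)
    (f := f) hne hcomp (fun p _ => (hfσ p).lowerSemicontinuous.lowerSemicontinuousOn _)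
    (fun p hp => ConvexOn.quasiconvexOn ⟨hconv, fun σ _ τ _ a b _ _ hab =>
      (haff p hp σ τ a b hab).le⟩)
    (convex_stdSimplex ℝ T) (fun σ _ => (hfp σ).upperSemicontinuous.upperSemicontinuousOn _)
    (fun σ _ => ConcaveOn.quasiconcaveOn ⟨convex_stdSimplex ℝ T, fun p _ q _ a b _ _ _ =>
      (hlin σ p q a b).ge⟩)
    hconv (s := Set.range fun i : T => Pi.single i (1 : ℝ)) (Set.finite_range _)
    (by rintro _ ⟨i, rfl⟩; exact single_mem_stdSimplex ℝ i) (t := t) (by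
      intro σ hσ
      obtain ⟨τ, hτ, hτσ⟩ := Set.mem_iUnion₂.1 (hT hσ)
      refine ⟨_, ⟨⟨τ, hτ⟩, rfl⟩, ?_⟩
      simpa [hf, hc, Pi.single_apply] using hτσ)
  have hmem : ∀ i ∈ (Finset.univ : Finset T), w i ∈ {A : Matrix κ κ ℂ | A.PosDef} := fun i _ =>
    hw i (hTK i i.2)
  refine ⟨∑ i, p i • w i, ?_, fun σ hσ => (hpt σ hσ).trans_le ?_⟩
  · exact concaveOn_matLog.1.sum_mem (fun i _ => hp.1 i) hp.2 hmem
  · have h1 := (concaveOn_trace_mul_matLog hρ.1).le_map_sum (fun i _ => hp.1 i) hp.2 hmem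
    have h2 : (σ * ∑ i, p i • w i).trace.re = ∑ i, p i * (σ * w i).trace.re := by
      simp [Finset.mul_sum, Matrix.trace_sum]
    rw [h2]
    simp only [hf, mul_sub, Finset.sum_sub_distrib]
    simp only [smul_eq_mul] at h1
    linarith

/-- Minimax exchange for the variational formula of the relative entropy. -/
lemma exists_forall_posDef_le {ρ : Matrix κ κ ℂ} (hρ : IsState ρ) {K : Set (Matrix κ κ ℂ)}
    (hK : ∀ σ ∈ K, IsState σ) (hne : K.Nonempty) (hconv : Convex ℝ K) (hcomp : IsCompact K) {b : ℝ}
    (h : ∀ ω : Matrix κ κ ℂ, ω.PosDef → (∀ σ ∈ K, (σ * ω).trace.re ≤ 1) →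
      (ρ * matLog ω).trace.re ≤ b) :
    ∃ σ ∈ K, ∀ ω : Matrix κ κ ℂ, ω.PosDef →
      (ρ * matLog ω).trace.re ≤ b + Real.log (σ * ω).trace.re := by
  have hsmul : ∀ (ω : Matrix κ κ ℂ) (r : ℝ), ω.PosDef → 0 < r → ((r : ℂ) • ω).PosDef :=
    fun ω r hω hr => hω.smul (by exact_mod_cast hr)
  obtain ⟨σ, hσ, hσω⟩ : ∃ σ ∈ K, ∀ ω : Matrix κ κ ℂ, ω.PosDef →
      (ρ * matLog ω).trace.re - (σ * ω).trace.re ≤ b - 1 := by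
    by_contra hcon
    push Not at hcon
    obtain ⟨ω, hω, hωK⟩ := exists_posDef_forall_lt hρ hne hconv hcomp hcon
    obtain ⟨τ, hτ, hmax⟩ := hcomp.exists_isMaxOn hne (continuous_re_trace_mul ω).continuousOn
    set m := (τ * ω).trace.re with hm
    have hm0 : 0 < m := trace_mul_re_pos (hK τ hτ) hω
    have h1 := h (((m⁻¹ : ℝ) : ℂ) • ω) (hsmul ω _ hω (inv_pos.2 hm0)) fun σ hσ => by
      rw [re_trace_smul_mul, inv_mul_le_one₀ hm0]
      exact hmax hσ
    rw [trace_mul_matLog_smul hρ hω (inv_pos.2 hm0), Real.log_inv] at h1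
    have h2 := hωK τ hτ
    have h3 := Real.log_le_sub_one_of_pos hm0
    linarith
  refine ⟨σ, hσ, fun ω hω => ?_⟩
  set m := (σ * ω).trace.re with hm
  have hm0 : 0 < m := trace_mul_re_pos (hK σ hσ) hω
  have h1 := hσω _ (hsmul ω _ hω (inv_pos.2 hm0))
  rw [trace_mul_matLog_smul hρ hω (inv_pos.2 hm0), Real.log_inv, re_trace_smul_mul, ← hm,
    inv_mul_cancel₀ hm0.ne'] at h1
  linarith

end Minimax

section Mixtures

set_option linter.unusedSectionVars false

variable {ι : Type*} [Fintype ι] [DecidableEq ι]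

instance instBorelSpaceMatC : BorelSpace (MatC ι) :=
  inferInstanceAs (BorelSpace (ι → ι → ℂ))

lemma iidMix_add_smul {C : Set (MatC ι)} (hC : ∀ σ ∈ C, IsState σ) (μ ν : Measure ↥C)
    [IsProbabilityMeasure μ] [IsProbabilityMeasure ν] {a b : ℝ} (ha : 0 ≤ a) (hb : 0 ≤ b) (n : ℕ) :
    iidMix (ENNReal.ofReal a • μ + ENNReal.ofReal b • ν) n = a • iidMix μ n + b • iidMix ν n := by
  ext i j
  have h1 := integrable_tensorPow_apply hC μ n i j
  have h2 := integrable_tensorPow_apply hC ν n i j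
  refine (integral_add_measure (h1.smul_measure ENNReal.ofReal_ne_top)
    (h2.smul_measure ENNReal.ofReal_ne_top)).trans ?_
  rw [integral_smul_measure, integral_smul_measure, ENNReal.toReal_ofReal ha,
    ENNReal.toReal_ofReal hb]
  rfl

lemma integrable_trace_tensorPow_mul {C : Set (MatC ι)} (hC : ∀ σ ∈ C, IsState σ) (μ : Measure ↥C)
    [IsProbabilityMeasure μ] (n : ℕ) (X : MatN ι n) :
    Integrable (fun σ : C => (tensorPow (σ : MatC ι) n * X).trace.re) μ := by
  refine Integrable.re (f := fun σ : C => (tensorPow (σ : MatC ι) n * X).trace) ?_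
  simp only [Matrix.trace, Matrix.diag, Matrix.mul_apply]
  exact integrable_finsetSum _ fun i _ => integrable_finsetSum _ fun j _ =>
    (integrable_tensorPow_apply hC μ n i j).mul_const _

/-- All mixtures of `n`-fold i.i.d. states along probability measures on `C`. -/
def mixSet (C : Set (MatC ι)) (n : ℕ) : Set (MatN ι n) :=
  Set.range fun μ : ProbabilityMeasure ↥C => iidMix (μ : Measure ↥C) n

lemma convex_mixSet {C : Set (MatC ι)} (hC : ∀ σ ∈ C, IsState σ) (n : ℕ) :
    Convex ℝ (mixSet C n) := by
  rintro _ ⟨μ, rfl⟩ _ ⟨ν, rfl⟩ a b ha hb hab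
  have : IsProbabilityMeasure
      (ENNReal.ofReal a • (μ : Measure ↥C) + ENNReal.ofReal b • (ν : Measure ↥C)) := by
    refine ⟨?_⟩
    simp [← ENNReal.ofReal_add ha hb, hab]
  exact ⟨⟨_, this⟩, iidMix_add_smul hC _ _ ha hb n⟩

lemma continuous_iidMix {C : Set (MatC ι)} (hC : ∀ σ ∈ C, IsState σ) (n : ℕ) :
    Continuous fun μ : ProbabilityMeasure ↥C => iidMix (μ : Measure ↥C) n := by
  refine continuous_pi fun i => continuous_pi fun j => ?_
  have hcont : Continuous fun σ : C => ∏ k, (σ : MatC ι) (i k) (j k) :=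
    continuous_finsetProd _ fun k _ =>
      (continuous_apply_apply (i k) (j k)).comp continuous_subtype_val
  have hb : ∀ σ : C, ‖∏ k, (σ : MatC ι) (i k) (j k)‖ ≤ 1 := fun σ => by
    rw [norm_prod]
    exact Finset.prod_le_one (fun _ _ => norm_nonneg _) fun k _ =>
      (hC σ σ.2).norm_apply_le _ _
  have key : ∀ g : ℂ →L[ℝ] ℝ, (∀ z, ‖g z‖ ≤ ‖z‖) → Continuous fun μ : ProbabilityMeasure ↥C =>
      ∫ σ : C, g (∏ k, (σ : MatC ι) (i k) (j k)) ∂(μ : Measure ↥C) := fun g hg =>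
    ProbabilityMeasure.continuous_integral_boundedContinuousFunction
      (BoundedContinuousFunction.ofNormedAddCommGroup _ (g.continuous.comp hcont) 1
        fun σ => (hg _).trans (hb σ))
  have heq : (fun μ : ProbabilityMeasure ↥C => iidMix (μ : Measure ↥C) n i j) =
      fun μ : ProbabilityMeasure ↥C =>
      ((∫ σ : C, Complex.reCLM (∏ k, (σ : MatC ι) (i k) (j k)) ∂(μ : Measure ↥C) : ℝ) : ℂ) +
      ((∫ σ : C, Complex.imCLM (∏ k, (σ : MatC ι) (i k) (j k)) ∂(μ : Measure ↥C) : ℝ) : ℂ) *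
        Complex.I := by
    ext μ
    have hint := integrable_tensorPow_apply hC (μ : Measure ↥C) n i j
    exact (integral_re_add_im hint).symm
  rw [heq]
  exact (Complex.continuous_ofReal.comp (key _ Complex.abs_re_le_norm)).add
    ((Complex.continuous_ofReal.comp (key _ Complex.abs_im_le_norm)).mul continuous_const)

lemma isCompact_mixSet {C : Set (MatC ι)} (hC : ∀ σ ∈ C, IsState σ) (hcl : IsClosed C) (n : ℕ) :
    IsCompact (mixSet C n) := by
  have : CompactSpace C := isCompact_iff_compactSpace.1 (isCompact_of_isState hC hcl)
  exact isCompact_range (continuous_iidMix hC n)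

lemma tensorPow_mem_mixSet {C : Set (MatC ι)} {σ : MatC ι} (hσ : σ ∈ C) (n : ℕ) :
    tensorPow σ n ∈ mixSet C n := by
  refine ⟨⟨Measure.dirac ⟨σ, hσ⟩, inferInstance⟩, ?_⟩
  ext i j
  simp [iidMix, tensorPow]

lemma exists_mix_of_not_hasWitness {B : Set (MatC ι)} (hB : ∀ σ ∈ B, IsState σ)
    (hBne : B.Nonempty) (hcl : IsClosed B) {ρ : MatC ι} (hρ : IsState ρ) {n : ℕ} (hn : 0 < n)
    {R : ℝ} (h : ¬ HasWitness B R ρ) :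
    ∃ μ : ProbabilityMeasure ↥B, ∀ ω : MatN ι n, ω.PosDef →
      (tensorPow ρ n * matLog ω).trace.re ≤
        n * R + Real.log (iidMix (μ : Measure ↥B) n * ω).trace.re := by
  have hK : ∀ σ ∈ mixSet B n, IsState σ := by
    rintro _ ⟨μ, rfl⟩
    exact isState_iidMix hB _ n
  obtain ⟨σ0, hσ0⟩ := hBne
  obtain ⟨_, ⟨μ, rfl⟩, hμ⟩ := exists_forall_posDef_le (hρ.tensorPow n) hK
    ⟨_, tensorPow_mem_mixSet hσ0 n⟩ (convex_mixSet hB n) (isCompact_mixSet hB hcl n)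
    (b := n * R) fun ω hω hle => by
      by_contra hcon
      push Not at hcon
      have he := exists_spec hω.isHermitian
      rw [he] at hle hcon
      rw [matLog_spec] at hcon
      exact h (hasWitness_of_lt hρ hn _ hω.eigenvalues_pos
        (fun σ hσ => hle _ (tensorPow_mem_mixSet hσ n)) hcon)
  exact ⟨μ, hμ⟩

lemma exists_universal_mix {B : Set (MatC ι)} (hB : ∀ σ ∈ B, IsState σ)
    (μ : ℕ → ProbabilityMeasure ↥B) :
    ∃ (ν : Measure ↥B) (T : ℝ), IsProbabilityMeasure ν ∧ 0 < T ∧ ∀ n, ∀ ω : MatN ι n, ω.PosDef →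
      (iidMix (μ n : Measure ↥B) n * ω).trace.re ≤
        T * ((n : ℝ) + 1) ^ 2 * (iidMix ν n * ω).trace.re := by
  set u : ℕ → ℝ := fun n => 1 / ((n : ℝ) + 1) ^ 2 with hu
  have hu0 : ∀ n, 0 < u n := fun n => by simp only [hu]; positivity
  have hsum : Summable u := by
    have := (summable_nat_add_iff 1).2 (Real.summable_one_div_nat_pow.2 one_lt_two)
    simpa [hu] using this
  set T : ℝ := ∑' n, u n with hT
  have hT0 : 0 < T := hsum.tsum_pos (fun n => (hu0 n).le) 0 (hu0 0)
  have hw0 : ∀ n, 0 < u n / T := fun n => div_pos (hu0 n) hT0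
  have hw1 : ∑' n, ENNReal.ofReal (u n / T) = 1 := by
    rw [← ENNReal.ofReal_tsum_of_nonneg (fun n => (hw0 n).le) (hsum.div_const T), tsum_div_const,
      div_self hT0.ne', ENNReal.ofReal_one]
  set ν : Measure ↥B := Measure.sum fun n => ENNReal.ofReal (u n / T) • (μ n : Measure ↥B) with hν
  have hνp : IsProbabilityMeasure ν := by
    refine ⟨?_⟩
    rw [hν, Measure.sum_apply _ MeasurableSet.univ]
    simpa using hw1
  refine ⟨ν, T, hνp, hT0, fun n ω hω => ?_⟩
  rw [trace_iidMix_mul hB, trace_iidMix_mul hB]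
  have hint : Integrable (fun σ : B => (tensorPow (σ : MatC ι) n * ω).trace.re) ν :=
    integrable_trace_tensorPow_mul hB ν n ω
  have h1 : ∫ σ : B, (tensorPow (σ : MatC ι) n * ω).trace.re
      ∂(ENNReal.ofReal (u n / T) • (μ n : Measure ↥B)) ≤
      ∫ σ : B, (tensorPow (σ : MatC ι) n * ω).trace.re ∂ν :=
    integral_mono_measure (Measure.le_sum _ n)
      (ae_of_all _ fun σ => trace_mul_re_nonneg ((hB σ σ.2).tensorPow n).1 hω.posSemidef) hint
  rw [integral_smul_measure, ENNReal.toReal_ofReal (hw0 n).le, smul_eq_mul, hu] at h1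
  have h2 : T * ((n : ℝ) + 1) ^ 2 * (1 / ((n : ℝ) + 1) ^ 2 / T) = 1 := by
    field_simp
  have h3 := mul_le_mul_of_nonneg_left h1 (a := T * ((n : ℝ) + 1) ^ 2) (by positivity)
  rwa [← mul_assoc, h2, one_mul] at h3

lemma exists_mix_relEnt_le {B : Set (MatC ι)} (hB : ∀ σ ∈ B, IsState σ)
    (hBne : B.Nonempty) (hcl : IsClosed B) {ρ : MatC ι} (hρ : IsState ρ) {S : ℝ}
    (h : ∀ R : ℝ, S < R → ¬ HasWitness B R ρ) :
    ∃ (ν : Measure ↥B) (c : ℝ), IsProbabilityMeasure ν ∧ ∀ n : ℕ, 0 < n →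
      relEnt (tensorPow ρ n) (iidMix ν n) ≤
        ((n * S + (c + (2 + Fintype.card ι * Fintype.card ι) * Real.log (n + 1)) : ℝ) : EReal) := by
  have hμ : ∀ n : ℕ, ∃ μ : ProbabilityMeasure ↥B, 0 < n → ∀ ω : MatN ι n, ω.PosDef →
      (tensorPow ρ n * matLog ω).trace.re ≤
        n * (S + 1 / n) + Real.log (iidMix (μ : Measure ↥B) n * ω).trace.re := by
    intro n
    rcases Nat.eq_zero_or_pos n with rfl | hn
    · obtain ⟨σ, hσ⟩ := hBne
      exact ⟨⟨Measure.dirac ⟨σ, hσ⟩, inferInstance⟩, fun h => absurd h (lt_irrefl _)⟩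
    · obtain ⟨μ, hμ⟩ := exists_mix_of_not_hasWitness hB hBne hcl hρ hn
        (h (S + 1 / n) (by
          have : (0 : ℝ) < n := by exact_mod_cast hn
          have : (0 : ℝ) < 1 / n := by positivity
          linarith))
      exact ⟨μ, fun _ => hμ⟩
  choose μ hμ using hμ
  obtain ⟨ν, T, hν, hT, hle⟩ := exists_universal_mix hB μ
  refine ⟨ν, 1 + Real.log T, hν, fun n hn => ?_⟩
  have hn' : (0 : ℝ) < n := by exact_mod_cast hn
  have hst := isState_iidMix hB ν n
  have hspec := exists_spec hst.1.1
  refine (relEnt_le_of_forall_posDef (c := n * S + 1 + Real.log (T * ((n : ℝ) + 1) ^ 2))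
    (hρ.tensorPow n) hst hspec
    ((permInv_iidMix ν n).card_eigenvalues_le hspec) fun ω hω => ?_).trans (le_of_eq ?_)
  · refine (hμ n hn ω hω).trans ?_
    have hpos := trace_mul_re_pos (isState_iidMix hB (μ n : Measure ↥B) n) hω
    have hpos' := trace_mul_re_pos hst hω
    have h1 := Real.log_le_log hpos (hle n ω hω)
    rw [Real.log_mul (by positivity) hpos'.ne'] at h1
    have h2 : (n : ℝ) * (S + 1 / n) = n * S + 1 := by field_simp
    linarith
  · rw [EReal.coe_eq_coe_iff, Real.log_mul hT.ne' (by positivity), Real.log_pow]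
    push_cast
    rw [Real.log_pow]
    push_cast
    ring

end Mixtures

section DoubleMin

set_option linter.unusedSectionVars false

variable {ι : Type*} [Fintype ι] [DecidableEq ι]

lemma steinExponent_nonneg {A B : Set (MatC ι)} (hB : ∀ σ ∈ B, IsState σ) (hBne : B.Nonempty) :
    0 ≤ steinExponent (iidSet A) (iidSet B) := by
  refine le_iInf₂ fun ε hε => le_liminf_of_le (by isBoundedDefault) (Eventually.of_forall fun n => ?_)
  have h1 : typeII (iidSet A n) (iidSet B n) ε ≤ 1 := by
    obtain ⟨σ, hσ⟩ := hBne
    have h0 : ((1 : MatN ι n) - 1).PosSemidef := by rw [sub_self]; exact Matrix.PosSemidef.zero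
    exact typeII_le (iidSet_isState hB n) ⟨_, σ, hσ, rfl⟩ Matrix.PosSemidef.one h0
      (fun ρ _ => by simpa using hε.1.le)
      fun τ hτ => (iidSet_isState hB n τ hτ).trace_mul_le_one h0
  have h2 := cFrac_mul_mono n (negLog_anti h1)
  rwa [negLog, if_neg (by norm_num), Real.log_one, neg_zero, cFrac_mul_coe, zero_div] at h2

lemma eventually_lt_of_lt_steinExponent {A B : Set (MatC ι)} (hA : ∀ ρ ∈ A, IsState ρ)
    (hB : ∀ σ ∈ B, IsState σ) {ρ : MatC ι} (hρ : ρ ∈ A) (μ : Measure ↥B) [IsProbabilityMeasure μ]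
    {a : EReal} (ha : a < steinExponent (iidSet A) (iidSet B)) :
    ∀ᶠ n in atTop, a < cFrac n * relEnt (tensorPow ρ n) (iidMix μ n) := by
  obtain ⟨z, haz, hz⟩ := EReal.lt_iff_exists_real_btwn.1 ha
  by_contra hcon
  refine absurd (steinExponent_le_of_frequently hA hB hρ μ (L := z) ?_) (not_le.2 hz)
  exact (not_eventually.1 hcon).mono fun n hn => (not_lt.1 hn).trans haz.le

lemma tendsto_add_log_div (S c b : ℝ) :
    Tendsto (fun n : ℕ => S + (c + b * Real.log (n + 1)) / n) atTop (𝓝 S) := by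
  have h1 : Tendsto (fun n : ℕ => Real.log ((n : ℝ) + 1) / n) atTop (𝓝 0) := by
    have := (Real.tendsto_pow_log_div_mul_add_atTop 1 (-1) 1 one_ne_zero).comp
      (tendsto_atTop_add_const_right _ (1 : ℝ) tendsto_natCast_atTop_atTop)
    refine this.congr fun n => ?_
    simp
  have h2 := tendsto_const_nhds (x := S).add
    ((tendsto_const_div_atTop_nhds_zero_nat c).add (h1.const_mul b))
  simp only [mul_zero, add_zero] at h2
  refine h2.congr fun n => ?_
  ring

lemma exists_tendsto_steinExponent {A B : Set (MatC ι)} (hA : ∀ ρ ∈ A, IsState ρ)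
    (hAne : A.Nonempty) (hAcl : IsClosed A) (hB : ∀ σ ∈ B, IsState σ) (hBne : B.Nonempty)
    (hBcl : IsClosed B) :
    ∃ ρ ∈ A, ∃ μ : Measure ↥B, IsProbabilityMeasure μ ∧
      Tendsto (fun n : ℕ => cFrac n * relEnt (tensorPow ρ n) (iidMix μ n)) atTop
        (𝓝 (steinExponent (iidSet A) (iidSet B))) := by
  induction hS : steinExponent (iidSet A) (iidSet B) with
  | bot =>
    have := steinExponent_nonneg (A := A) hB hBne
    rw [hS] at this
    exact absurd this (not_le.2 EReal.bot_lt_zero)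
  | top =>
    obtain ⟨ρ, hρ⟩ := hAne
    obtain ⟨σ, hσ⟩ := hBne
    refine ⟨ρ, hρ, Measure.dirac ⟨σ, hσ⟩, inferInstance, tendsto_order.2 ⟨fun a ha => ?_,
      fun a ha => absurd ha not_top_lt⟩⟩
    rw [← hS] at ha
    exact eventually_lt_of_lt_steinExponent hA hB hρ _ ha
  | coe S =>
    obtain ⟨ρ, hρ, hR⟩ := exists_not_hasWitness hA hB hBne (isCompact_of_isState hA hAcl) hS
    obtain ⟨ν, c, hν, hle⟩ := exists_mix_relEnt_le hB hBne hBcl (hA ρ hρ) hR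
    refine ⟨ρ, hρ, ν, hν, tendsto_order.2 ⟨fun a ha => ?_, fun a ha => ?_⟩⟩
    · rw [← hS] at ha
      exact eventually_lt_of_lt_steinExponent hA hB hρ _ ha
    · have hlim := (continuous_coe_real_ereal.tendsto S).comp
        (tendsto_add_log_div S c (2 + Fintype.card ι * Fintype.card ι))
      filter_upwards [hlim.eventually_lt_const ha, eventually_gt_atTop 0] with n hn hn0
      refine lt_of_le_of_lt ?_ hn
      refine (cFrac_mul_mono n (hle n hn0)).trans (le_of_eq ?_)
      have : (n : ℝ) ≠ 0 := by exact_mod_cast hn0.ne'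
      rw [cFrac_mul_coe, Function.comp_apply, EReal.coe_eq_coe_iff]
      field_simp

end DoubleMin

/-- **Composite i.i.d. null versus convex composite i.i.d. alternative, with both
optimisations outside the limit.**
`Stein(𝒜₁^{iid}‖ℬ₁^{iid}) = min*_{ρ∈𝒜₁, μ∈𝒫(ℬ₁)} lim_n (1/n) D(ρ^{⊗n}‖∫dμ(σ) σ^{⊗n})`. -/
theorem composite_iid_vs_convex_iid_double_min (d : ℕ)
    (A1 B1 : Set (MatC (Fin d)))
    (hA_states : ∀ ρ ∈ A1, IsState ρ) (hA_ne : A1.Nonempty) (hA_closed : IsClosed A1)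
    (hB_states : ∀ σ ∈ B1, IsState σ) (hB_ne : B1.Nonempty) (hB_closed : IsClosed B1)
    (hB_convex : Convex ℝ B1) :
    ∃ S : EReal,
      steinExponent (iidSet A1) (iidSet B1) = S ∧
      (∃ ρ ∈ A1, ∃ μ : Measure ↥B1, IsProbabilityMeasure μ ∧
        Filter.Tendsto (fun n : ℕ => cFrac n * relEnt (tensorPow ρ n) (iidMix μ n))
          Filter.atTop (nhds S)) ∧
      (∀ ρ ∈ A1, ∀ μ : Measure ↥B1, IsProbabilityMeasure μ → ∀ L : EReal,
        Filter.Tendsto (fun n : ℕ => cFrac n * relEnt (tensorPow ρ n) (iidMix μ n))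
          Filter.atTop (nhds L) → S ≤ L) := by
  refine ⟨_, rfl, exists_tendsto_steinExponent hA_states hA_ne hA_closed hB_states hB_ne hB_closed,
    fun ρ hρ μ hμ L hL => ?_⟩
  by_contra hlt
  obtain ⟨z, hLz, hz⟩ := exists_between (not_le.1 hlt)
  have h := eventually_lt_of_lt_steinExponent hA_states hB_states hρ μ hz
  exact absurd (ge_of_tendsto hL (h.mono fun _ hn => hn.le)) (not_le.2 hLz)

end QSanov
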